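/- arXiv:2507.16072 — 11 statements merged into one kernel-verified Lean document; each statement's English description precedes it below -/
import Mathlib

section
/- Consider the transmission-delay Hegselmann–Krause system. Assume the communication weights satisfy the sub-stochasticity condition ∑_{j≠i} ψ_ij(t) ≤ 1 for all t ≥ 0 and all i, and the global positivity property: for every R > 0 there exists ψ̲ = ψ̲(R) > 0 such that for every T > 0, if |x_i(t) − x_j(t)| ≤ R for all t ∈ [−τ, T] and all i, j, then ψ_ij(t) ≥ ψ̲/(N−1) for all t ∈ [0, T] and all i ≠ j. Then every solution reaches global asymptotic consensus, i.e. lim_{t→∞} d_x(t) = 0. -/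
open Filter MeasureTheory Set


/-- Scalar version of the system. -/
structure ScalarHK (N : ℕ) (τ : ℝ) (u : Fin N → ℝ → ℝ) (ψ : Fin N → Fin N → ℝ → ℝ) : Prop where
  cont : ∀ i, ContinuousOn (u i) (Ici (-τ))
  nn : ∀ i j, i ≠ j → ∀ t, 0 ≤ t → 0 ≤ ψ i j t
  ode : ∀ i, ∀ t : ℝ, 0 < t → HasDerivAt (u i)
      (∑ j ∈ Finset.univ.erase i, ψ i j t * (u j (t - τ) - u i t)) t
  sub : ∀ t : ℝ, 0 ≤ t → ∀ i, ∑ j ∈ Finset.univ.erase i, ψ i j t ≤ 1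

theorem nonneg_of_deriv {f f' : ℝ → ℝ} {a b : ℝ} (hab : a ≤ b)
    (hc : ContinuousOn f (Icc a b)) (hd : ∀ t ∈ Ioo a b, HasDerivAt f (f' t) t)
    (ha : 0 ≤ f a) (h : ∀ t ∈ Ioo a b, f t < 0 → 0 ≤ f' t) : 0 ≤ f b := by
  by_contra! hb
  have hS : IsCompact (Icc a b ∩ f ⁻¹' Ici 0) :=
    isCompact_Icc.of_isClosed_subset (hc.preimage_isClosed_of_isClosed isClosed_Icc isClosed_Ici)
      inter_subset_left
  obtain ⟨s, ⟨⟨hs1, hs2⟩, hs3⟩, hs4⟩ := hS.exists_isGreatest ⟨a, ⟨le_refl a, hab⟩, ha⟩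
  have hs3' : 0 ≤ f s := hs3
  have hsb : s < b := lt_of_le_of_ne hs2 (by rintro rfl; linarith)
  obtain ⟨c, hc1, hc2⟩ := exists_hasDerivAt_eq_slope f f' hsb
    (hc.mono (Icc_subset_Icc_left hs1)) (fun t ht => hd t ⟨lt_of_le_of_lt hs1 ht.1, ht.2⟩)
  have hcneg : f c < 0 := by
    by_contra! hh
    have := hs4 ⟨⟨hs1.trans hc1.1.le, hc1.2.le⟩, hh⟩
    exact absurd hc1.1 (not_lt.2 this)
  have h0 := h c ⟨lt_of_le_of_lt hs1 hc1.1, hc1.2⟩ hcneg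
  rw [hc2] at h0
  have : (f b - f s) / (b - s) < 0 := div_neg_of_neg_of_pos (by linarith) (by linarith)
  linarith

namespace ScalarHK

variable {N : ℕ} {τ : ℝ} {u : Fin N → ℝ → ℝ} {ψ : Fin N → Fin N → ℝ → ℝ}

theorem neg (H : ScalarHK N τ u ψ) : ScalarHK N τ (fun i t => - u i t) ψ where
  cont i := (H.cont i).neg
  nn := H.nn
  sub := H.sub
  ode i t ht := by
    have := (H.ode i t ht).neg
    refine HasDerivAt.congr_deriv this ?_
    rw [← Finset.sum_neg_distrib]
    exact Finset.sum_congr rfl fun j _ => by ring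

theorem inv_step (H : ScalarHK N τ u ψ) (hτ : 0 < τ) {T m : ℝ} (hT : 0 ≤ T)
    (h : ∀ i, ∀ t ∈ Icc (T - τ) T, m ≤ u i t) : ∀ i, ∀ t ∈ Icc T (T + τ), m ≤ u i t := by
  intro i t ht
  have := nonneg_of_deriv (f := fun t => u i t - m) (a := T) (b := t) ht.1
    (((H.cont i).mono (fun s hs => by simp only [mem_Ici]; linarith [hs.1])).sub continuousOn_const)
    (fun s hs => (H.ode i s (by linarith [hs.1])).sub_const m)
    (by linarith [h i T ⟨by linarith, le_refl _⟩])
    (by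
      intro s hs hneg
      apply Finset.sum_nonneg
      intro j hj
      have hji : i ≠ j := (Finset.ne_of_mem_erase hj).symm
      apply mul_nonneg (H.nn i j hji s (by linarith [hs.1]))
      have := h j (s - τ) ⟨by linarith [hs.1], by linarith [hs.2, ht.2]⟩
      linarith)
  linarith

theorem inv (H : ScalarHK N τ u ψ) (hτ : 0 < τ) {T m : ℝ} (hT : 0 ≤ T)
    (h : ∀ i, ∀ t ∈ Icc (T - τ) T, m ≤ u i t) : ∀ i, ∀ t, T - τ ≤ t → m ≤ u i t := by
  have key : ∀ n : ℕ, ∀ i, ∀ t ∈ Icc (T - τ) (T + n * τ), m ≤ u i t := by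
    intro n
    induction n with
    | zero => simpa using h
    | succ n ih =>
      intro i t ht
      have hn : (0:ℝ) ≤ n * τ := by positivity
      rcases le_total t (T + n * τ) with h1 | h1
      · exact ih i t ⟨ht.1, h1⟩
      · refine H.inv_step hτ (T := T + n * τ) (by linarith) ?_ i t ⟨h1, ?_⟩
        · intro j s hs
          exact ih j s ⟨by linarith [hs.1], hs.2⟩
        · have := ht.2
          push_cast at this
          linarith
  intro i t ht
  obtain ⟨n, hn⟩ := exists_nat_ge ((t - T) / τ)
  rw [div_le_iff₀ hτ] at hn
  exact key n i t ⟨ht, by linarith⟩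

theorem sum_split (H : ScalarHK N τ u ψ) {m t : ℝ} (ht : 0 ≤ t) (i : Fin N) (hm : m ≤ u i t) :
    (∑ j ∈ Finset.univ.erase i, ψ i j t * (u j (t - τ) - m)) - (u i t - m) ≤
    ∑ j ∈ Finset.univ.erase i, ψ i j t * (u j (t - τ) - u i t) := by
  have e : ∑ j ∈ Finset.univ.erase i, ψ i j t * (u j (t - τ) - u i t)
      = (∑ j ∈ Finset.univ.erase i, ψ i j t * (u j (t - τ) - m))
        - (∑ j ∈ Finset.univ.erase i, ψ i j t) * (u i t - m) := by
    rw [Finset.sum_mul, ← Finset.sum_sub_distrib]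
    exact Finset.sum_congr rfl fun j _ => by ring
  rw [e]
  nlinarith [H.sub t ht i]

/-- Comparison with a scalar linear equation. -/
theorem compare (H : ScalarHK N τ u ψ) {m a b β : ℝ} (ha : 0 ≤ a) (hτ : 0 < τ) (hab : a ≤ b)
    (i : Fin N) (hm : ∀ t ∈ Icc a b, m ≤ u i t)
    (hβ : ∀ t ∈ Ioo a b, β ≤ ∑ j ∈ Finset.univ.erase i, ψ i j t * (u j (t - τ) - m)) :
    β + Real.exp (-(b - a)) * (u i a - m - β) ≤ u i b - m := by
  have hexp : ∀ t : ℝ, HasDerivAt (fun t => Real.exp (-(t - a)) * (u i a - m - β))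
      (-(Real.exp (-(t - a)) * (u i a - m - β))) t := by
    intro t
    have := ((((hasDerivAt_id t).sub_const a).neg).exp).mul_const (u i a - m - β)
    refine HasDerivAt.congr_deriv this ?_
    simp
  have := nonneg_of_deriv
    (f := fun t => (u i t - m - β) - Real.exp (-(t - a)) * (u i a - m - β))
    (f' := fun t => (∑ j ∈ Finset.univ.erase i, ψ i j t * (u j (t - τ) - u i t))
      - -(Real.exp (-(t - a)) * (u i a - m - β))) hab
    ((((H.cont i).mono (fun s hs => by
        simp only [mem_Ici]; linarith [hs.1])).sub continuousOn_const).sub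
        continuousOn_const |>.sub
      (fun t _ => (hexp t).continuousAt.continuousWithinAt))
    (fun t ht => (((H.ode i t (by linarith [ht.1])).sub_const m).sub_const β).sub (hexp t))
    (by simp)
    (by
      intro t ht hneg
      have h1 := H.sum_split (t := t) (by linarith [ht.1]) i (hm t ⟨ht.1.le, ht.2.le⟩)
      have h2 := hβ t ht
      linarith)
  linarith

theorem low (H : ScalarHK N τ u ψ) (hτ : 0 < τ) {c : ℝ} (hc : 0 < c)
    (hψ : ∀ i j, i ≠ j → ∀ t, 0 ≤ t → c ≤ ψ i j t) {T m : ℝ} (hT : 0 ≤ T)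
    (h : ∀ i, ∀ t ∈ Icc (T - τ) T, m ≤ u i t) (k : Fin N) {α : ℝ}
    (hα1 : α ≤ Real.exp (-(3 * τ)))
    (hα2 : α ≤ c * Real.exp (-(2 * τ)) * (1 - Real.exp (-τ))) :
    ∀ i, ∀ t ∈ Icc (T + 2 * τ) (T + 3 * τ), m + α * (u k T - m) ≤ u i t := by
  have hinv := H.inv hτ hT h
  have hv : 0 ≤ u k T - m := by linarith [hinv k T (by linarith)]
  have hsum : ∀ i t, T ≤ t → ∀ j ∈ Finset.univ.erase i, 0 ≤ ψ i j t * (u j (t - τ) - m) := by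
    intro i t ht j hj
    have hji : i ≠ j := (Finset.ne_of_mem_erase hj).symm
    exact mul_nonneg (H.nn i j hji t (by linarith)) (by linarith [hinv j (t - τ) (by linarith)])
  have hk : ∀ t, T ≤ t → Real.exp (-(t - T)) * (u k T - m) ≤ u k t - m := by
    intro t ht
    have := H.compare (m := m) (β := 0) hT hτ ht k (fun s hs => hinv k s (by linarith [hs.1]))
      (fun s hs => Finset.sum_nonneg (hsum k s hs.1.le))
    simpa using this
  intro i t ht
  by_cases hik : i = k
  · subst hik
    have h1 := hk t (by linarith [ht.1])
    have h2 : Real.exp (-(3 * τ)) ≤ Real.exp (-(t - T)) :=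
      Real.exp_le_exp.2 (by linarith [ht.2])
    have := mul_le_mul_of_nonneg_right (hα1.trans h2) hv
    linarith
  · set w := Real.exp (-(2 * τ)) * (u k T - m) with hw
    have hw0 : 0 ≤ w := mul_nonneg (Real.exp_pos _).le hv
    have h1 := H.compare (m := m) (a := T + τ) (b := t) (β := c * w) (by linarith) hτ
      (by linarith [ht.1]) i (fun s hs => hinv i s (by linarith [hs.1]))
      (fun s hs => by
        have hkm : k ∈ Finset.univ.erase i := Finset.mem_erase.2 ⟨fun e => hik e.symm, Finset.mem_univ _⟩
        refine le_trans ?_ (Finset.single_le_sum (hsum i s (by linarith [hs.1])) hkm)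
        have h2 := hk (s - τ) (by linarith [hs.1])
        have h3 : Real.exp (-(2 * τ)) ≤ Real.exp (-(s - τ - T)) :=
          Real.exp_le_exp.2 (by linarith [hs.2, ht.2])
        have h4 := mul_le_mul_of_nonneg_right h3 hv
        exact mul_le_mul (hψ i k hik s (by linarith [hs.1])) (by linarith) hw0
          (H.nn i k hik s (by linarith [hs.1])))
    have h5 : Real.exp (-(t - (T + τ))) ≤ Real.exp (-τ) :=
      Real.exp_le_exp.2 (by linarith [ht.1])
    have h6 : 0 ≤ u i (T + τ) - m := by linarith [hinv i (T + τ) (by linarith)]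
    have h7 := mul_nonneg (Real.exp_pos (-(t - (T + τ)))).le h6
    have h8 := mul_le_mul_of_nonneg_right h5 (mul_nonneg hc.le hw0)
    have h9 := mul_le_mul_of_nonneg_right hα2 hv
    have h10 : c * Real.exp (-(2 * τ)) * (1 - Real.exp (-τ)) * (u k T - m)
      = c * w - Real.exp (-τ) * (c * w) := by rw [hw]; ring
    linarith

theorem bounded (H : ScalarHK N τ u ψ) (hτ : 0 < τ) :
    ∃ C : ℝ, ∀ i, ∀ t, -τ ≤ t → |u i t| ≤ C := by
  have h1 : ∀ i, ∃ C, ∀ t ∈ Icc (-τ) 0, ‖u i t‖ ≤ C := fun i =>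
    isCompact_Icc.exists_bound_of_continuousOn ((H.cont i).mono Icc_subset_Ici_self)
  choose C hC using h1
  have h2 : ∀ i, ∀ t ∈ Icc (-τ) 0, |u i t| ≤ ∑ j, |C j| := fun i t ht =>
    (hC i t ht).trans ((le_abs_self _).trans
      (Finset.single_le_sum (f := fun j => |C j|) (fun j _ => abs_nonneg _) (Finset.mem_univ i)))
  refine ⟨∑ j, |C j|, fun i t ht => abs_le.2 ⟨?_, ?_⟩⟩
  · exact H.inv hτ le_rfl (fun j s hs => (abs_le.1 (h2 j s (by simpa using hs))).1) i t (by simpa)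
  · have := H.neg.inv hτ le_rfl (m := -∑ j, |C j|)
      (fun j s hs => neg_le_neg (abs_le.1 (h2 j s (by simpa using hs))).2) i t (by simpa)
    simpa using this

theorem consensus (H : ScalarHK N τ u ψ) (hτ : 0 < τ) {c : ℝ} (hc : 0 < c)
    (hψ : ∀ i j, i ≠ j → ∀ t, 0 ≤ t → c ≤ ψ i j t) (k l : Fin N) :
    Tendsto (fun t => |u k t - u l t|) atTop (nhds 0) := by
  obtain ⟨C, hC⟩ := H.bounded hτ
  set α := min (Real.exp (-(3 * τ))) (c * Real.exp (-(2 * τ)) * (1 - Real.exp (-τ))) with hα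
  have he : Real.exp (-τ) < 1 := by rw [← Real.exp_zero, Real.exp_lt_exp]; linarith
  have he3 : Real.exp (-(3 * τ)) < 1 := by rw [← Real.exp_zero, Real.exp_lt_exp]; linarith
  have hα1 : α ≤ Real.exp (-(3 * τ)) := min_le_left _ _
  have hα2 : α ≤ c * Real.exp (-(2 * τ)) * (1 - Real.exp (-τ)) := min_le_right _ _
  have hα0 : 0 < α := lt_min (Real.exp_pos _)
    (mul_pos (mul_pos hc (Real.exp_pos _)) (by linarith))
  have key : ∀ n : ℕ, ∃ m M : ℝ, M - m ≤ (1 - α) ^ n * (2 * C) ∧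
      ∀ i, ∀ t, n * (3 * τ) - τ ≤ t → m ≤ u i t ∧ u i t ≤ M := by
    intro n
    induction n with
    | zero =>
      refine ⟨-C, C, by simp; linarith, fun i t ht => abs_le.1 (hC i t (by simpa using ht))⟩
    | succ n ih =>
      obtain ⟨m, M, hmM, hb⟩ := ih
      set T : ℝ := n * (3 * τ) with hTdef
      have hT : 0 ≤ T := by positivity
      have hlow := H.low hτ hc hψ hT (fun i t ht => (hb i t ht.1).1) k hα1 hα2
      have hup := H.neg.low hτ hc hψ hT (m := -M)
        (fun i t ht => neg_le_neg (hb i t ht.1).2) k hα1 hα2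
      refine ⟨m + α * (u k T - m), M - α * (M - u k T), ?_, ?_⟩
      · have := mul_le_mul_of_nonneg_left hmM (by linarith : 0 ≤ 1 - α)
        rw [pow_succ]
        nlinarith
      · intro i t ht
        have e : ((n + 1 : ℕ) : ℝ) * (3 * τ) = T + 3 * τ := by push_cast; ring
        rw [e] at ht
        constructor
        · exact H.inv hτ (T := T + 3 * τ) (by linarith)
            (fun j s hs => hlow j s ⟨by linarith [hs.1], hs.2⟩) i t ht
        · have := H.neg.inv hτ (T := T + 3 * τ) (by linarith)
            (fun j s hs => hup j s ⟨by linarith [hs.1], hs.2⟩) i t ht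
          linarith
  rw [Metric.tendsto_atTop]
  intro ε hε
  have hlim : Tendsto (fun n : ℕ => (1 - α) ^ n * (2 * C)) atTop (nhds 0) := by
    simpa using (tendsto_pow_atTop_nhds_zero_of_lt_one (by linarith : 0 ≤ 1 - α)
      (by linarith)).mul_const (2 * C)
  obtain ⟨n, hn⟩ := (hlim.eventually_lt_const hε).exists
  obtain ⟨m, M, hmM, hb⟩ := key n
  refine ⟨n * (3 * τ), fun t ht => ?_⟩
  have h1 := hb k t (by linarith)
  have h2 := hb l t (by linarith)
  rw [Real.dist_eq, sub_zero, abs_abs]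
  exact abs_lt.2 ⟨by linarith, by linarith⟩

end ScalarHK

theorem eucl_norm_le {d : ℕ} (y : EuclideanSpace ℝ (Fin d)) : ‖y‖ ≤ ∑ l, |y l| := by
  have h := (EuclideanSpace.basisFun (Fin d) ℝ).sum_repr y
  calc ‖y‖ = ‖∑ l, y l • EuclideanSpace.basisFun (Fin d) ℝ l‖ := by
        conv_lhs => rw [← h]
        simp
    _ ≤ ∑ l, ‖y l • EuclideanSpace.basisFun (Fin d) ℝ l‖ := norm_sum_le _ _
    _ = ∑ l, |y l| := by simp [norm_smul]

/-- Transmission-delay Hegselmann–Krause system with sub-stochastic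
communication weights and the global positivity property reaches global asymptotic
consensus: the group diameter tends to zero. -/
theorem transmission_delay_consensus_classical
    (N d : ℕ) (hN : 2 ≤ N) (hd : 1 ≤ d) (τ : ℝ) (hτ : 0 < τ)
    (x : Fin N → ℝ → EuclideanSpace ℝ (Fin d))
    (ψ : Fin N → Fin N → ℝ → ℝ)
    -- continuity of the trajectories on [-τ, ∞)
    (hxc : ∀ i, ContinuousOn (x i) (Ici (-τ)))
    -- nonnegativity and continuity of the communication weights on [0, ∞)
    (hψc : ∀ i j, i ≠ j → ContinuousOn (ψ i j) (Ici 0))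
    (hψnn : ∀ i j, i ≠ j → ∀ t, 0 ≤ t → 0 ≤ ψ i j t)
    -- the transmission-delay Hegselmann–Krause system
    (hode : ∀ i, ∀ t : ℝ, 0 < t → HasDerivAt (x i)
      (∑ j ∈ Finset.univ.erase i, ψ i j t • (x j (t - τ) - x i t)) t)
    -- sub-stochasticity: ∑_{j≠i} ψ_ij(t) ≤ 1
    (hsub : ∀ t : ℝ, 0 ≤ t → ∀ i, ∑ j ∈ Finset.univ.erase i, ψ i j t ≤ 1)
    -- global positivity property
    (hpos : ∀ R > (0:ℝ), ∃ ψl > (0:ℝ), ∀ T > (0:ℝ),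
      (∀ t ∈ Icc (-τ) T, ∀ i j, ‖x i t - x j t‖ ≤ R) →
      ∀ t ∈ Icc (0:ℝ) T, ∀ i j, i ≠ j → ψl / ((N:ℝ) - 1) ≤ ψ i j t)
    -- the group diameter d_x(t) = max_{i,j} |x_i(t) - x_j(t)|
    (dx : ℝ → ℝ)
    (hdx : ∀ t : ℝ, -τ ≤ t → IsGreatest {r | ∃ i j, r = ‖x i t - x j t‖} (dx t)) :
    Tendsto dx atTop (nhds 0) := by
  have H : ∀ l : Fin d, ScalarHK N τ (fun i t => x i t l) ψ := by
    intro l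
    refine ⟨fun i => ?_, hψnn, fun i t ht => ?_, hsub⟩
    · exact (EuclideanSpace.proj (𝕜 := ℝ) l).continuous.comp_continuousOn (hxc i)
    · have := (EuclideanSpace.proj (𝕜 := ℝ) (ι := Fin d) l).hasFDerivAt.comp_hasDerivAt t (hode i t ht)
      refine HasDerivAt.congr_deriv this ?_
      simp [map_sum]
  have hb := fun l => (H l).bounded hτ
  choose C hC using hb
  obtain ⟨ψl, hψl, hψ⟩ := hpos (∑ l, 2 * |C l| + 1)
    (add_pos_of_nonneg_of_pos (Finset.sum_nonneg fun l _ => by positivity) one_pos)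
  have hN1 : (0:ℝ) < (N:ℝ) - 1 := by
    have : (2:ℝ) ≤ N := by exact_mod_cast hN
    linarith
  have hlow : ∀ i j, i ≠ j → ∀ t, 0 ≤ t → ψl / ((N:ℝ) - 1) ≤ ψ i j t := by
    intro i j hij t ht
    refine hψ (t + 1) (by linarith) ?_ t ⟨ht, by linarith⟩ i j hij
    intro s hs i j
    refine (eucl_norm_le _).trans ?_
    have : ∑ l, |(x i s - x j s) l| ≤ ∑ l, 2 * |C l| := by
      refine Finset.sum_le_sum fun l _ => ?_
      have h1 := abs_le.1 (hC l i s hs.1)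
      have h2 := abs_le.1 (hC l j s hs.1)
      have h3 := le_abs_self (C l)
      simp only [PiLp.sub_apply]
      exact abs_le.2 ⟨by linarith, by linarith⟩
    linarith
  have hcons := fun l k j => (H l).consensus hτ (div_pos hψl hN1) hlow k j
  have hlim : Tendsto (fun t => ∑ i, ∑ j, ∑ l, |x i t l - x j t l|) atTop (nhds 0) := by
    have := tendsto_finsetSum Finset.univ fun i _ => tendsto_finsetSum Finset.univ fun j _ =>
      tendsto_finsetSum Finset.univ fun l _ => hcons l i j
    simpa using this
  refine tendsto_of_tendsto_of_tendsto_of_le_of_le' tendsto_const_nhds hlim ?_ ?_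
  · filter_upwards [eventually_ge_atTop 0] with t ht
    obtain ⟨i, j, h⟩ := (hdx t (by linarith)).1
    rw [h]
    exact norm_nonneg _
  · filter_upwards [eventually_ge_atTop 0] with t ht
    obtain ⟨i, j, h⟩ := (hdx t (by linarith)).1
    rw [h]
    refine (eucl_norm_le _).trans ?_
    simp only [PiLp.sub_apply]
    refine le_trans ?_ (Finset.single_le_sum
      (f := fun i => ∑ j, ∑ l, |x i t l - x j t l|) (fun i _ => by positivity) (Finset.mem_univ i))
    exact Finset.single_le_sum
      (f := fun j => ∑ l, |x i t l - x j t l|) (fun i _ => by positivity) (Finset.mem_univ j)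
end

section
/- Consider the transmission-delay Hegselmann–Krause system with N ≥ 3 agents. Assume the communication weights satisfy the convexity (normalization) property ∑_{j≠i} ψ_ij(t) = 1 for all t ≥ 0 and all i, and that there exists ψ̲ ∈ (0, 1) with ψ_ij(t) ≥ ψ̲/(N−1) for all t ≥ 0 and all i ≠ j. Then there exists a constant C > 0 solving 1 − C = (1 − ((N−2)/(N−1)) ψ̲) e^{Cτ} such that the group diameter decays exponentially: d_x(t) ≤ (max_{s ∈ [−τ, 0]} d_x(s)) e^{−C t} for all t ≥ 0; in particular lim_{t→∞} d_x(t) = 0. -/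
open Filter MeasureTheory Set

theorem hk_coupling {N : ℕ} {E : Type*} [NormedAddCommGroup E] [NormedSpace ℝ E]
    (p q : Fin N → ℝ) (y : Fin N → E) (m δ : ℝ) (hm : 0 < m)
    (hp : ∀ j, 0 ≤ p j) (hq : ∀ j, 0 ≤ q j) (hps : ∑ j, p j = m) (hqs : ∑ j, q j = m)
    (hy : ∀ a b, ‖y a - y b‖ ≤ δ) :
    ‖∑ j, p j • y j - ∑ j, q j • y j‖ ≤ m * δ := by
  have key : m • (∑ j, p j • y j - ∑ j, q j • y j)
      = ∑ j, ∑ l, (p j * q l) • (y j - y l) := by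
    have h1 : ∑ j, ∑ l, (p j * q l) • y j = m • ∑ j, p j • y j := by
      rw [Finset.smul_sum]
      refine Finset.sum_congr rfl fun j _ => ?_
      rw [← Finset.sum_smul, ← Finset.mul_sum, hqs, smul_smul, mul_comm]
    have h2 : ∑ j, ∑ l, (p j * q l) • y l = m • ∑ j, q j • y j := by
      rw [Finset.sum_comm, Finset.smul_sum]
      refine Finset.sum_congr rfl fun j _ => ?_
      rw [← Finset.sum_smul, ← Finset.sum_mul, hps, smul_smul]
    simp only [smul_sub, Finset.sum_sub_distrib, h1, h2]
  have h3 : ‖m • (∑ j, p j • y j - ∑ j, q j • y j)‖ ≤ m * (m * δ) := by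
    rw [key]
    calc _ ≤ ∑ j, ∑ l, (p j * q l) * δ := by
            refine norm_sum_le_of_le _ fun j _ => norm_sum_le_of_le _ fun l _ => ?_
            rw [norm_smul, Real.norm_of_nonneg (mul_nonneg (hp j) (hq l))]
            exact mul_le_mul_of_nonneg_left (hy j l) (mul_nonneg (hp j) (hq l))
      _ = m * (m * δ) := by
            simp only [← Finset.sum_mul, ← Finset.mul_sum, hps, hqs]
            ring
  rw [norm_smul, Real.norm_of_nonneg hm.le] at h3
  exact le_of_mul_le_mul_left h3 hm

theorem hk_diff {N : ℕ} {E : Type*} [NormedAddCommGroup E] [NormedSpace ℝ E]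
    (hN : 3 ≤ N) (ψl : ℝ) (hψl : ψl ∈ Ioo (0:ℝ) 1) (w : Fin N → Fin N → ℝ) (y : Fin N → E) (δ : ℝ)
    (hw : ∀ i j, i ≠ j → ψl / ((N:ℝ) - 1) ≤ w i j)
    (hs : ∀ i, ∑ j ∈ Finset.univ.erase i, w i j = 1)
    (hy : ∀ a b, ‖y a - y b‖ ≤ δ) (i k : Fin N) (hik : i ≠ k)
    (hm : 0 < 1 - (((N:ℝ) - 2) / ((N:ℝ) - 1)) * ψl) :
    ‖∑ j ∈ Finset.univ.erase i, w i j • y j - ∑ j ∈ Finset.univ.erase k, w k j • y j‖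
      ≤ (1 - (((N:ℝ) - 2) / ((N:ℝ) - 1)) * ψl) * δ := by
  have hN' : (3:ℝ) ≤ N := by exact_mod_cast hN
  have hc0 : 0 ≤ ψl / ((N:ℝ) - 1) := div_nonneg hψl.1.le (by linarith)
  set c : Fin N → ℝ := fun j => if j = i ∨ j = k then 0 else ψl / ((N:ℝ) - 1) with hc
  have hcs : ∑ j, c j = (((N:ℝ) - 2) / ((N:ℝ) - 1)) * ψl := by
    have h0 : ∀ j, c j = ψl / ((N:ℝ) - 1) - (if j = i then ψl / ((N:ℝ) - 1) else 0)
        - (if j = k then ψl / ((N:ℝ) - 1) else 0) := by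
      intro j
      simp only [hc]
      by_cases h1 : j = i
      · have : j ≠ k := fun h => hik (h1.symm.trans h)
        simp [h1, hik]
      · by_cases h2 : j = k <;> simp [h1, h2, hik.symm]
    simp only [h0, Finset.sum_sub_distrib, Finset.sum_ite_eq', Finset.mem_univ, if_true,
      Finset.sum_const, Finset.card_univ, Fintype.card_fin, nsmul_eq_mul]
    ring
  have er : ∀ (i : Fin N) (f : Fin N → ℝ),
      ∑ j ∈ Finset.univ.erase i, f j = ∑ j, if j = i then 0 else f j := by
    intro i f
    rw [← Finset.sum_erase Finset.univ (a := i) (by simp)]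
    exact Finset.sum_congr rfl fun j hj => by simp [Finset.ne_of_mem_erase hj]
  have er' : ∀ (i : Fin N) (f : Fin N → ℝ),
      ∑ j ∈ Finset.univ.erase i, f j • y j = ∑ j, (if j = i then 0 else f j) • y j := by
    intro i f
    rw [← Finset.sum_erase Finset.univ (a := i) (by simp)]
    exact Finset.sum_congr rfl fun j hj => by simp [Finset.ne_of_mem_erase hj]
  have := hk_coupling (fun j => (if j = i then 0 else w i j) - c j)
    (fun j => (if j = k then 0 else w k j) - c j) y _ δ hm ?_ ?_ ?_ ?_ hy
  · simp only [sub_smul, Finset.sum_sub_distrib] at this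
    rw [er', er']
    simpa using this
  · intro j
    simp only [hc]
    by_cases h1 : j = i
    · simp [h1]
    · have := hw i j (Ne.symm h1)
      by_cases h2 : j = k
      · subst h2; simp [h1]; linarith
      · simp [h1, h2]; linarith
  · intro j
    simp only [hc]
    by_cases h1 : j = k
    · simp [h1]
    · have := hw k j (Ne.symm h1)
      by_cases h2 : j = i
      · subst h2; simp [h1]; linarith
      · simp [h1, h2]; linarith
  · rw [Finset.sum_sub_distrib, ← er, hs, hcs]
  · rw [Finset.sum_sub_distrib, ← er, hs, hcs]

/-- Transmission-delay Hegselmann–Krause system with normalized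
(convex) communication weights bounded below: exponential decay of the diameter with
rate `C` solving `1 - C = (1 - ((N-2)/(N-1)) ψ̲) e^{Cτ}`, hence asymptotic consensus. -/
theorem transmission_delay_consensus_normalized
    (N d : ℕ) (hN : 3 ≤ N) (hd : 1 ≤ d) (τ : ℝ) (hτ : 0 < τ)
    (x : Fin N → ℝ → EuclideanSpace ℝ (Fin d))
    (ψ : Fin N → Fin N → ℝ → ℝ)
    (hxc : ∀ i, ContinuousOn (x i) (Ici (-τ)))
    (hψc : ∀ i j, i ≠ j → ContinuousOn (ψ i j) (Ici 0))
    (hψnn : ∀ i j, i ≠ j → ∀ t, 0 ≤ t → 0 ≤ ψ i j t)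
    -- the transmission-delay Hegselmann–Krause system
    (hode : ∀ i, ∀ t : ℝ, 0 < t → HasDerivAt (x i)
      (∑ j ∈ Finset.univ.erase i, ψ i j t • (x j (t - τ) - x i t)) t)
    -- normalization (convexity) property: ∑_{j≠i} ψ_ij(t) = 1
    (hconv : ∀ t : ℝ, 0 ≤ t → ∀ i, ∑ j ∈ Finset.univ.erase i, ψ i j t = 1)
    -- uniform lower bound ψ_ij(t) ≥ ψ̲/(N-1) with ψ̲ ∈ (0,1)
    (ψl : ℝ) (hψl : ψl ∈ Ioo (0:ℝ) 1)
    (hlb : ∀ t : ℝ, 0 ≤ t → ∀ i j, i ≠ j → ψl / ((N:ℝ) - 1) ≤ ψ i j t)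
    -- the group diameter and its maximum over the initial interval [-τ, 0]
    (dx : ℝ → ℝ)
    (hdx : ∀ t : ℝ, -τ ≤ t → IsGreatest {r | ∃ i j, r = ‖x i t - x j t‖} (dx t))
    (M0 : ℝ) (hM0 : IsGreatest {r | ∃ s ∈ Icc (-τ) (0:ℝ), r = dx s} M0) :
    ∃ C > (0:ℝ),
      1 - C = (1 - (((N:ℝ) - 2) / ((N:ℝ) - 1)) * ψl) * Real.exp (C * τ) ∧
      (∀ t : ℝ, 0 ≤ t → dx t ≤ M0 * Real.exp (-C * t)) ∧
      Tendsto dx atTop (nhds 0) := by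
  have hN' : (3:ℝ) ≤ N := by exact_mod_cast hN
  set m : ℝ := 1 - (((N:ℝ) - 2) / ((N:ℝ) - 1)) * ψl with hmdef
  have hr0 : 0 < ((N:ℝ) - 2) / ((N:ℝ) - 1) := div_pos (by linarith) (by linarith)
  have hr1 : ((N:ℝ) - 2) / ((N:ℝ) - 1) < 1 := by
    rw [div_lt_one (by linarith)]; linarith
  have hm : 0 < m := by nlinarith [hψl.1, hψl.2]
  have hm1 : m < 1 := by nlinarith [hψl.1, hψl.2]
  obtain ⟨C, hC, hCe⟩ : ∃ C > (0:ℝ), 1 - C = m * Real.exp (C * τ) := by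
    have hcont : ContinuousOn (fun C : ℝ => m * Real.exp (C * τ) + C - 1) (Icc 0 1) := by fun_prop
    have := intermediate_value_Ioo (zero_le_one) hcont
    obtain ⟨C, hC, h⟩ := this (show (0:ℝ) ∈ _ by
      constructor
      · simp; linarith
      · simp; positivity)
    refine ⟨C, hC.1, ?_⟩
    simp only at h
    linarith
  have hpair : ∀ t, -τ ≤ t → ∀ a b, ‖x a t - x b t‖ ≤ dx t :=
    fun t ht a b => (hdx t ht).2 ⟨a, b, rfl⟩
  have hinit : ∀ s ∈ Icc (-τ) (0:ℝ), dx s ≤ M0 := fun s hs => hM0.2 ⟨s, hs, rfl⟩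
  have hnn : ∀ t, -τ ≤ t → 0 ≤ dx t :=
    fun t ht => (norm_nonneg _).trans (hpair t ht ⟨0, by omega⟩ ⟨0, by omega⟩)
  have hM : 0 ≤ M0 := (hnn 0 (by linarith)).trans (hinit 0 ⟨by linarith, le_rfl⟩)
  have main : ∀ n : ℕ, ∀ u, -τ ≤ u → u ≤ n * τ → ∀ a b,
      ‖x a u - x b u‖ ≤ M0 * Real.exp (-C * u) := by
    intro n
    induction n with
    | zero =>
      intro u hu hu0 a b
      have hu0 : u ≤ 0 := by simpa using hu0
      refine ((hpair u hu a b).trans (hinit u ⟨hu, hu0⟩)).trans ?_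
      refine le_mul_of_one_le_right hM (Real.one_le_exp ?_)
      nlinarith
    | succ n ih =>
      intro t ht htn i k
      by_cases htn' : t ≤ n * τ
      · exact ih t ht htn' i k
      have ht0 : 0 < t := lt_of_le_of_lt (by positivity) (not_le.1 htn')
      push_cast at htn
      by_cases hik : i = k
      · subst hik; simp; positivity
      set v := x i t - x k t with hv
      set h : ℝ → ℝ := fun s => Real.exp s * inner ℝ v (x i s - x k s)
        - ‖v‖ * M0 * Real.exp ((1 - C) * s) with hh
      have hcont : ContinuousOn h (Icc 0 t) := by
        have hsub : Icc 0 t ⊆ Ici (-τ) := fun s hs => by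
          have := hs.1; simp only [mem_Ici]; linarith
        have h1 := (hxc i).mono hsub
        have h2 := (hxc k).mono hsub
        fun_prop
      have hder : ∀ s ∈ Ioo 0 t, ∃ h', HasDerivAt h h' s ∧ h' ≤ 0 := by
        intro s hs
        have hd1 := (hode i s hs.1).sub (hode k s hs.1)
        have hsum : ∀ i, ∑ j ∈ Finset.univ.erase i, ψ i j s • (x j (s - τ) - x i s)
            = ∑ j ∈ Finset.univ.erase i, ψ i j s • x j (s - τ) - x i s := by
          intro i
          simp only [smul_sub, Finset.sum_sub_distrib]
          rw [← Finset.sum_smul, hconv s hs.1.le i, one_smul]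
        rw [hsum, hsum] at hd1
        have hD := hk_diff hN ψl hψl (fun i j => ψ i j s) (fun j => x j (s - τ))
          (M0 * Real.exp (-C * (s - τ))) (hlb s hs.1.le) (hconv s hs.1.le)
          (fun a b => ih (s - τ) (by linarith [hs.1]) (by linarith [hs.2]) a b) i k hik hm
        set A := ∑ j ∈ Finset.univ.erase i, ψ i j s • x j (s - τ)
        set B := ∑ j ∈ Finset.univ.erase k, ψ k j s • x j (s - τ)
        have hd2 := (hasDerivAt_const s v).inner ℝ hd1
        have hd3 := (Real.hasDerivAt_exp s).mul hd2
        have hd4 := (((hasDerivAt_id s).const_mul (1 - C)).exp).const_mul (‖v‖ * M0)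
        refine ⟨_, hd3.sub hd4, ?_⟩
        have hin : inner ℝ v (A - B) ≤ ‖v‖ * (m * (M0 * Real.exp (-C * (s - τ)))) :=
          (real_inner_le_norm _ _).trans (mul_le_mul_of_nonneg_left hD (norm_nonneg _))
        have he : m * (M0 * Real.exp (-C * (s - τ))) = (1 - C) * M0 * Real.exp (-C * s) := by
          rw [hCe, show -C * (s - τ) = C * τ + -C * s by ring, Real.exp_add]; ring
        rw [he] at hin
        have he2 : Real.exp ((1 - C) * s) = Real.exp s * Real.exp (-C * s) := by
          rw [← Real.exp_add]; congr 1; ring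
        have hin2 := mul_le_mul_of_nonneg_left hin (Real.exp_pos s).le
        have hexp : inner ℝ v ((A - x i s) - (B - x k s))
            = inner ℝ v (A - B) - inner ℝ v (x i s - x k s) := by
          rw [← inner_sub_right]; congr 1; abel
        simp only [id, inner_zero_left, add_zero, Pi.sub_apply, hexp, he2, mul_one]
        linarith
      have hanti : AntitoneOn h (Icc 0 t) := by
        refine antitoneOn_of_deriv_nonpos (convex_Icc 0 t) hcont ?_ ?_
        · intro s hs
          rw [interior_Icc] at hs
          obtain ⟨h', h1, -⟩ := hder s hs
          exact h1.differentiableAt.differentiableWithinAt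
        · intro s hs
          rw [interior_Icc] at hs
          obtain ⟨h', h1, h2⟩ := hder s hs
          rw [h1.deriv]; exact h2
      have hle := hanti (left_mem_Icc.2 ht0.le) (right_mem_Icc.2 ht0.le) ht0.le
      have h0 : h 0 ≤ 0 := by
        have h1 : inner ℝ v (x i 0 - x k 0) ≤ ‖v‖ * M0 :=
          (real_inner_le_norm _ _).trans (mul_le_mul_of_nonneg_left
            ((hpair 0 (by linarith) i k).trans (hinit 0 ⟨by linarith, le_rfl⟩)) (norm_nonneg _))
        simp only [hh, Real.exp_zero, mul_zero]
        linarith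
      have h1 : h t ≤ 0 := hle.trans h0
      simp only [hh, ← hv, real_inner_self_eq_norm_sq] at h1
      have he2 : Real.exp ((1 - C) * t) = Real.exp t * Real.exp (-C * t) := by
        rw [← Real.exp_add]; congr 1; ring
      rw [he2] at h1
      rcases (norm_nonneg v).eq_or_lt with hv0 | hv0
      · rw [← hv0]; positivity
      · have hpos : 0 < Real.exp t * ‖v‖ := by positivity
        refine le_of_mul_le_mul_left ?_ hpos
        linarith
  have hfin : ∀ t : ℝ, 0 ≤ t → dx t ≤ M0 * Real.exp (-C * t) := by
    intro t ht
    obtain ⟨n, hn⟩ := exists_nat_ge (t / τ)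
    obtain ⟨a, b, hab⟩ := (hdx t (by linarith)).1
    rw [hab]
    exact main n t (by linarith) ((div_le_iff₀ hτ).1 hn) a b
  refine ⟨C, hC, hCe, hfin, ?_⟩
  have hlim : Tendsto (fun t : ℝ => M0 * Real.exp (-C * t)) atTop (nhds 0) := by
    have h1 : Tendsto (fun t : ℝ => -C * t) atTop atBot :=
      tendsto_id.const_mul_atTop_of_neg (by linarith)
    simpa using (Real.tendsto_exp_atBot.comp h1).const_mul M0
  refine tendsto_of_tendsto_of_tendsto_of_le_of_le' tendsto_const_nhds hlim ?_ ?_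
  · filter_upwards [eventually_ge_atTop (0:ℝ)] with t ht using hnn t (by linarith)
  · filter_upwards [eventually_ge_atTop (0:ℝ)] with t ht using hfin t ht
end

section
/- Consider the reaction-delay Hegselmann–Krause system. Assume the communication weights are symmetric, ψ_ij(t) = ψ_ji(t) for all i ≠ j and t ≥ 0, bounded above by ψ_ij(t) ≤ 1/(N−1), and satisfy the global positivity property: for every R > 0 there exists ψ̲ = ψ̲(R) > 0 such that for every T > 0, if |x_i(t) − x_j(t)| ≤ R for all t ∈ [−τ, T] and all i, j, then ψ_ij(t) ≥ ψ̲/(N−1) for all t ∈ [0, T] and all i ≠ j. If τ < 1/2, then every solution reaches global asymptotic consensus, i.e. lim_{t→∞} d_x(t) = 0. -/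
open Filter MeasureTheory Set

lemma rd_norm_sq {E : Type*} [NormedAddCommGroup E] [InnerProductSpace ℝ E] {N : ℕ}
    (a : Fin N → ℝ) (v : Fin N → E) (h0 : ∀ j, 0 ≤ a j) (h1 : ∑ j, a j ≤ 1) :
    ‖∑ j, a j • v j‖ ^ 2 ≤ ∑ j, a j * ‖v j‖ ^ 2 := by
  have h2 : ‖∑ j, a j • v j‖ ≤ ∑ j, a j * ‖v j‖ := by
    refine (norm_sum_le _ _).trans (Finset.sum_le_sum fun j _ => ?_)
    rw [norm_smul, Real.norm_of_nonneg (h0 j)]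
  have h3 : (∑ j, a j * ‖v j‖) ^ 2 ≤ (∑ j, a j) * ∑ j, a j * ‖v j‖ ^ 2 := by
    apply Finset.sum_sq_le_sum_mul_sum_of_sq_le_mul
    · intro j _; exact h0 j
    · intro j _; exact mul_nonneg (h0 j) (sq_nonneg _)
    · intro j _; exact le_of_eq (by ring)
  have h4 : 0 ≤ ∑ j, a j * ‖v j‖ ^ 2 :=
    Finset.sum_nonneg fun j _ => mul_nonneg (h0 j) (sq_nonneg _)
  have h5 := pow_le_pow_left₀ (norm_nonneg _) h2 2
  nlinarith

lemma rd_sym {E : Type*} [NormedAddCommGroup E] [InnerProductSpace ℝ E] {N : ℕ}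
    (a : Fin N → Fin N → ℝ) (v : Fin N → E) (hs : ∀ i j, a i j = a j i) :
    ∑ i, inner ℝ (∑ j, a i j • (v j - v i)) (v i)
      = -(∑ i, ∑ j, a i j * ‖v j - v i‖ ^ 2) / 2 := by
  have e1 : ∑ i, inner ℝ (∑ j, a i j • (v j - v i)) (v i)
      = ∑ i, ∑ j, a i j * inner ℝ (v j - v i) (v i) := by
    refine Finset.sum_congr rfl fun i _ => ?_
    rw [sum_inner]
    refine Finset.sum_congr rfl fun j _ => ?_
    rw [real_inner_smul_left]
  have e2 : ∑ i, ∑ j, a i j * inner ℝ (v j - v i) (v i)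
      = ∑ i, ∑ j, a i j * inner ℝ (v i - v j) (v j) := by
    rw [Finset.sum_comm]
    refine Finset.sum_congr rfl fun i _ => Finset.sum_congr rfl fun j _ => ?_
    rw [hs]
  have e3 : (∑ i, ∑ j, a i j * inner ℝ (v j - v i) (v i))
      + (∑ i, ∑ j, a i j * inner ℝ (v i - v j) (v j))
      = -(∑ i, ∑ j, a i j * ‖v j - v i‖ ^ 2) := by
    simp only [← Finset.sum_add_distrib, ← Finset.sum_neg_distrib]
    refine Finset.sum_congr rfl fun i _ => Finset.sum_congr rfl fun j _ => ?_
    rw [← real_inner_self_eq_norm_sq]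
    simp only [inner_sub_left, inner_sub_right]
    rw [real_inner_comm (v i) (v j)]
    ring
  rw [e1]
  linarith

/-- Core Lyapunov estimate. -/
lemma rd_core {E : Type*} [NormedAddCommGroup E] [InnerProductSpace ℝ E] {N : ℕ}
    (τ : ℝ) (hτ : 0 < τ) (hsmall : τ < 1 / 2)
    (y : Fin N → ℝ → E) (u : Fin N → ℝ → E) (D : ℝ → ℝ) (hDc : Continuous D)
    (hyc : ∀ i, Continuous (y i))
    (hy : ∀ i t, 0 < t → HasDerivAt (y i) (u i t) t)
    (hD0 : ∀ t, 0 ≤ D t)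
    (hu : ∀ t, ∑ i, ‖u i t‖ ^ 2 ≤ D t)
    (hs : ∀ t, ∑ i, inner ℝ (u i t) (y i (t - τ)) = - D t / 2) :
    ∃ M, ∀ t, τ ≤ t → (∫ s in (0:ℝ)..t, D s) ≤ M ∧ ∑ i, ‖y i t‖ ^ 2 ≤ M := by
  set G : ℝ → ℝ := fun t => ∫ s in (0:ℝ)..t, D s with hG
  have hGd : ∀ t, HasDerivAt G (D t) t := fun t =>
    intervalIntegral.integral_hasDerivAt_right (hDc.intervalIntegrable _ _)
      (hDc.stronglyMeasurableAtFilter _ _) hDc.continuousAt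
  have hGc : Continuous G := continuous_iff_continuousAt.2 fun t => (hGd t).continuousAt
  set H : ℝ → ℝ := fun t => ∫ s in (0:ℝ)..t, G s with hH
  have hHd : ∀ t, HasDerivAt H (G t) t := fun t =>
    intervalIntegral.integral_hasDerivAt_right (hGc.intervalIntegrable _ _)
      (hGc.stronglyMeasurableAtFilter _ _) hGc.continuousAt
  have hHc : Continuous H := continuous_iff_continuousAt.2 fun t => (hHd t).continuousAt
  have hGm : Monotone G := monotone_of_hasDerivAt_nonneg hGd hD0
  -- cross term
  have hcross : ∀ t, τ ≤ t → ∑ i, inner ℝ (u i t) (y i t)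
      ≤ - D t / 2 + τ / 2 * D t + (G t - G (t - τ)) / 2 := by
    intro t ht
    set f : ℝ → ℝ := fun s => ∑ i, inner ℝ (u i t) (y i s) - (s / 2 * D t + G s / 2) with hf
    have hfc : Continuous f := by
      rw [hf]; fun_prop
    have hfd : ∀ s, 0 < s → HasDerivAt f
        (∑ i, inner ℝ (u i t) (u i s) - (1 / 2 * D t + D s / 2)) s := by
      intro s hs
      refine HasDerivAt.sub (HasDerivAt.fun_sum fun i _ => ?_) (HasDerivAt.add ?_ ?_)
      · simpa using (hasDerivAt_const s (u i t)).inner ℝ (hy i s hs)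
      · exact ((hasDerivAt_id s).div_const 2).mul_const _
      · exact (hGd s).div_const 2
    have hanti : AntitoneOn f (Ici 0) := by
      apply antitoneOn_of_deriv_nonpos (convex_Ici 0) hfc.continuousOn
      · intro s hs
        rw [interior_Ici] at hs
        exact (hfd s hs).differentiableAt.differentiableWithinAt
      · intro s hs
        rw [interior_Ici] at hs
        rw [(hfd s hs).deriv]
        have : ∑ i, inner ℝ (u i t) (u i s) ≤ ∑ i, (‖u i t‖ ^ 2 / 2 + ‖u i s‖ ^ 2 / 2) := by
          refine Finset.sum_le_sum fun i _ => ?_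
          have := real_inner_le_norm (u i t) (u i s)
          nlinarith [sq_nonneg (‖u i t‖ - ‖u i s‖)]
        rw [Finset.sum_add_distrib, ← Finset.sum_div, ← Finset.sum_div] at this
        linarith [hu t, hu s]
    have := hanti (a := t - τ) (b := t) (by simp; linarith) (by simp; linarith) (by linarith)
    simp only [hf] at this
    rw [hs t] at this
    linarith
  set L : ℝ → ℝ := fun t => (∑ i, ‖y i t‖ ^ 2) / 2 + (τ * G t - (H t - H (t - τ))) / 2
    + (1 / 2 - τ) * G t with hL
  have hLc : Continuous L := by rw [hL]; fun_prop
  have hLd : ∀ t, 0 < t → HasDerivAt L ((∑ i, 2 * inner ℝ (y i t) (u i t)) / 2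
      + (τ * D t - (G t - G (t - τ))) / 2 + (1 / 2 - τ) * D t) t := by
    intro t ht
    refine HasDerivAt.add (HasDerivAt.add (HasDerivAt.div_const (HasDerivAt.fun_sum fun i _ => ?_) _)
      (HasDerivAt.div_const (HasDerivAt.sub ?_ (HasDerivAt.sub (hHd t) ?_)) _)) ?_
    · exact (hy i t ht).norm_sq
    · exact (hGd t).const_mul _
    · exact (hHd (t - τ)).comp_sub_const t τ
    · exact (hGd t).const_mul _
  have hLanti : AntitoneOn L (Ici τ) := by
    apply antitoneOn_of_deriv_nonpos (convex_Ici τ) hLc.continuousOn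
    · intro s hs
      rw [interior_Ici] at hs
      exact (hLd s (hτ.trans hs)).differentiableAt.differentiableWithinAt
    · intro s hs
      rw [interior_Ici] at hs
      rw [(hLd s (hτ.trans hs)).deriv, ← Finset.mul_sum]
      have h1 := hcross s (le_of_lt hs)
      simp only [real_inner_comm] at h1 ⊢
      have h2 : ∑ i, inner ℝ (y i s) (u i s) = ∑ i, inner ℝ (u i s) (y i s) :=
        Finset.sum_congr rfl fun i _ => real_inner_comm _ _
      linarith
  have hHb : ∀ t, H t - H (t - τ) ≤ τ * G t := by
    intro t
    have : AntitoneOn (fun s => H s - s * G t) (Iic t) := by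
      have hd : ∀ s, HasDerivAt (fun s => H s - s * G t) (G s - 1 * G t) s := fun s =>
        (hHd s).sub ((hasDerivAt_id s).mul_const _)
      apply antitoneOn_of_deriv_nonpos (convex_Iic t)
      · exact fun s _ => (hd s).continuousAt.continuousWithinAt
      · exact fun s _ => (hd s).differentiableAt.differentiableWithinAt
      · intro s hs
        rw [interior_Iic] at hs
        rw [(hd s).deriv]
        linarith [hGm (le_of_lt hs)]
    have := this (a := t - τ) (b := t) (by simp; linarith) (by simp) (by linarith)
    simp only at this
    linarith
  have hc : 0 < 1 / 2 - τ := by linarith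
  refine ⟨max (L τ / (1 / 2 - τ)) (2 * L τ), fun t ht => ?_⟩
  have h1 : L t ≤ L τ := hLanti (by simp) ht ht
  have h2 : 0 ≤ ∑ i, ‖y i t‖ ^ 2 := Finset.sum_nonneg fun i _ => sq_nonneg _
  have h3 := hHb t
  have h4 : 0 ≤ G t := by
    have : G 0 = 0 := by simp [hG]
    rw [← this]; exact hGm (by linarith)
  have h5 : L t = (∑ i, ‖y i t‖ ^ 2) / 2 + (τ * G t - (H t - H (t - τ))) / 2
    + (1 / 2 - τ) * G t := rfl
  have h6 := mul_nonneg hc.le h4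
  constructor
  · refine le_trans ?_ (le_max_left _ _)
    rw [le_div_iff₀ hc]
    change G t * _ ≤ _
    linarith
  · refine le_trans ?_ (le_max_right _ _)
    linarith

theorem reaction_delay_consensus_symmetric
    (N d : ℕ) (hN : 2 ≤ N) (hd : 1 ≤ d) (τ : ℝ) (hτ : 0 < τ)
    (x : Fin N → ℝ → EuclideanSpace ℝ (Fin d))
    (ψ : Fin N → Fin N → ℝ → ℝ)
    (hxc : ∀ i, ContinuousOn (x i) (Ici (-τ)))
    (hψc : ∀ i j, i ≠ j → ContinuousOn (ψ i j) (Ici 0))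
    (hψnn : ∀ i j, i ≠ j → ∀ t, 0 ≤ t → 0 ≤ ψ i j t)
    -- the reaction-delay Hegselmann–Krause system
    (hode : ∀ i, ∀ t : ℝ, 0 < t → HasDerivAt (x i)
      (∑ j ∈ Finset.univ.erase i, ψ i j t • (x j (t - τ) - x i (t - τ))) t)
    -- symmetry of the communication weights
    (hsym : ∀ i j, i ≠ j → ∀ t : ℝ, 0 ≤ t → ψ i j t = ψ j i t)
    -- upper bound ψ_ij(t) ≤ 1/(N-1)
    (hub : ∀ i j, i ≠ j → ∀ t : ℝ, 0 ≤ t → ψ i j t ≤ 1 / ((N:ℝ) - 1))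
    -- global positivity property
    (hpos : ∀ R > (0:ℝ), ∃ ψl > (0:ℝ), ∀ T > (0:ℝ),
      (∀ t ∈ Icc (-τ) T, ∀ i j, ‖x i t - x j t‖ ≤ R) →
      ∀ t ∈ Icc (0:ℝ) T, ∀ i j, i ≠ j → ψl / ((N:ℝ) - 1) ≤ ψ i j t)
    -- smallness of the delay
    (hsmall : τ < 1/2)
    -- the group diameter
    (dx : ℝ → ℝ)
    (hdx : ∀ t : ℝ, -τ ≤ t → IsGreatest {r | ∃ i j, r = ‖x i t - x j t‖} (dx t)) :
    Tendsto dx atTop (nhds 0) := by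
  have hN1 : (0:ℝ) < (N:ℝ) - 1 := by
    have : (2:ℝ) ≤ N := by exact_mod_cast hN
    linarith
  set y : Fin N → ℝ → EuclideanSpace ℝ (Fin d) := fun i t => x i (max t (-τ)) with hy
  have hyx : ∀ i t, -τ ≤ t → y i t = x i t := fun i t ht => by simp [hy, max_eq_left ht]
  have hyc : ∀ i, Continuous (y i) := fun i =>
    (hxc i).comp_continuous (by fun_prop) (fun t => by simp)
  set a : Fin N → Fin N → ℝ → ℝ := fun i j t => if i = j then 0 else ψ i j (max t 0) with ha
  have hac : ∀ i j, Continuous (a i j) := by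
    intro i j
    by_cases h : i = j
    · simp only [ha, h, if_true]; exact continuous_const
    · simp only [ha, h, if_false]
      exact (hψc i j h).comp_continuous (by fun_prop) (fun t => by simp)
  have ha0 : ∀ i j t, 0 ≤ a i j t := by
    intro i j t
    by_cases h : i = j
    · simp [ha, h]
    · simp only [ha, h, if_false]; exact hψnn i j h _ (le_max_right _ _)
  have has : ∀ t i j, a i j t = a j i t := by
    intro t i j
    by_cases h : i = j
    · simp [h]
    · simp only [ha, h, Ne.symm h, if_false]
      exact hsym i j h _ (le_max_right _ _)
  have hasum : ∀ i t (w : Fin N → ℝ), ∑ j, a i j t * w j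
      = ∑ j ∈ Finset.univ.erase i, ψ i j (max t 0) * w j := by
    intro i t w
    rw [← Finset.sum_erase (s := Finset.univ) (a := i) (by simp [ha])]
    refine Finset.sum_congr rfl fun j hj => ?_
    simp [ha, (Finset.ne_of_mem_erase hj).symm]
  have ha1 : ∀ i t, ∑ j, a i j t ≤ 1 := by
    intro i t
    have := hasum i t (fun _ => 1)
    simp only [mul_one] at this
    rw [this]
    have h1 : ∑ j ∈ Finset.univ.erase i, ψ i j (max t 0)
        ≤ ∑ j ∈ Finset.univ.erase i, 1 / ((N:ℝ) - 1) :=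
      Finset.sum_le_sum fun j hj => hub i j (Finset.ne_of_mem_erase hj).symm _ (le_max_right _ _)
    refine h1.trans ?_
    rw [Finset.sum_const, Finset.card_erase_of_mem (Finset.mem_univ _), Finset.card_univ,
      Fintype.card_fin, nsmul_eq_mul, Nat.cast_sub (by omega)]
    push_cast
    rw [mul_one_div_cancel hN1.ne']
  set u : Fin N → ℝ → EuclideanSpace ℝ (Fin d) :=
    fun i t => ∑ j, a i j t • (y j (t - τ) - y i (t - τ)) with hu
  set D : ℝ → ℝ := fun t => ∑ i, ∑ j, a i j t * ‖y j (t - τ) - y i (t - τ)‖ ^ 2 with hD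
  have huc : ∀ i, Continuous (u i) := by
    intro i; simp only [hu]; fun_prop
  have hDc : Continuous D := by
    simp only [hD]; fun_prop
  have hD0 : ∀ t, 0 ≤ D t := fun t => Finset.sum_nonneg fun i _ => Finset.sum_nonneg fun j _ =>
    mul_nonneg (ha0 i j t) (sq_nonneg _)
  have hder : ∀ i t, 0 < t → HasDerivAt (y i) (u i t) t := by
    intro i t ht
    have h1 := hode i t ht
    have h2 : u i t = ∑ j ∈ Finset.univ.erase i, ψ i j t • (x j (t - τ) - x i (t - τ)) := by
      simp only [hu]
      rw [← Finset.sum_erase (s := Finset.univ) (a := i) (by simp)]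
      refine Finset.sum_congr rfl fun j hj => ?_
      rw [hyx _ _ (by linarith), hyx _ _ (by linarith)]
      simp [ha, (Finset.ne_of_mem_erase hj).symm, max_eq_left ht.le]
    rw [h2]
    refine h1.congr_of_eventuallyEq ?_
    filter_upwards [lt_mem_nhds ht] with s hs
    exact hyx i s (by linarith)
  have huD : ∀ t, ∑ i, ‖u i t‖ ^ 2 ≤ D t := fun t => Finset.sum_le_sum fun i _ =>
    rd_norm_sq (fun j => a i j t) _ (fun j => ha0 i j t) (ha1 i t)
  obtain ⟨M, hM⟩ := rd_core τ hτ hsmall y u D hDc hyc hder hD0 huD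
    (fun t => rd_sym (fun i j => a i j t) (fun i => y i (t - τ)) (has t))
  -- uniform bound on distances
  have hbd : ∃ B, ∀ t, -τ ≤ t → ∑ i, ‖y i t‖ ^ 2 ≤ B := by
    have hc : Continuous fun t => ∑ i, ‖y i t‖ ^ 2 := by fun_prop
    obtain ⟨B, hB⟩ := (isCompact_Icc (a := -τ) (b := τ)).bddAbove_image hc.continuousOn
    refine ⟨max B M, fun t ht => ?_⟩
    rcases le_total t τ with h | h
    · exact (hB ⟨t, ⟨ht, h⟩, rfl⟩).trans (le_max_left _ _)
    · exact (hM t h).2.trans (le_max_right _ _)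
  obtain ⟨B, hB⟩ := hbd
  have hB0 : 0 ≤ B := (Finset.sum_nonneg fun i _ => sq_nonneg _).trans (hB 0 (by linarith))
  have hnb : ∀ t, -τ ≤ t → ∀ i, ‖x i t‖ ≤ B + 1 := by
    intro t ht i
    have h1 := hB t ht
    have h2 := Finset.single_le_sum (f := fun i => ‖y i t‖ ^ 2) (fun i _ => sq_nonneg _)
      (Finset.mem_univ i)
    simp only [hyx i t ht] at h2
    nlinarith [norm_nonneg (x i t), sq_nonneg (‖x i t‖ - 1)]
  obtain ⟨p, hp0, hp⟩ := hpos (2 * (B + 1)) (by linarith)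
  have hlow : ∀ t, 0 ≤ t → ∀ i j, i ≠ j → p / ((N:ℝ) - 1) ≤ ψ i j t := by
    intro t ht i j hij
    refine hp (t + 1) (by linarith) ?_ t ⟨ht, by linarith⟩ i j hij
    intro s hs i j
    have := norm_sub_le (x i s) (x j s)
    linarith [hnb s hs.1 i, hnb s hs.1 j]
  set q := p / ((N:ℝ) - 1) with hq
  have hq0 : 0 < q := div_pos hp0 hN1
  -- pair distance bounded by dissipation
  have hpair : ∀ i j t, 0 < t → ‖y i t - y j t‖ ^ 2 ≤ q⁻¹ * D (t + τ) := by
    intro i j t ht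
    by_cases hij : i = j
    · subst hij
      simpa using mul_nonneg (inv_nonneg.2 hq0.le) (hD0 (t + τ))
    · rw [← div_eq_inv_mul, le_div_iff₀ hq0]
      have h1 : a i j (t + τ) * ‖y j t - y i t‖ ^ 2 ≤ D (t + τ) := by
        have h2 := Finset.single_le_sum
          (f := fun j => a i j (t + τ) * ‖y j (t + τ - τ) - y i (t + τ - τ)‖ ^ 2)
          (fun j _ => mul_nonneg (ha0 i j _) (sq_nonneg _)) (Finset.mem_univ j)
        have h3 := Finset.single_le_sum
          (f := fun i => ∑ j, a i j (t + τ) * ‖y j (t + τ - τ) - y i (t + τ - τ)‖ ^ 2)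
          (fun i _ => Finset.sum_nonneg fun j _ => mul_nonneg (ha0 i j _) (sq_nonneg _))
          (Finset.mem_univ i)
        have h4 := h2.trans h3
        simpa only [hD, add_sub_cancel_right] using h4
      have h5 : q ≤ a i j (t + τ) := by
        have hpt : 0 ≤ t + τ := by linarith
        simp only [ha, hij, if_false, max_eq_left hpt]
        exact hlow _ hpt i j hij
      rw [norm_sub_rev]
      nlinarith [sq_nonneg ‖y j t - y i t‖]
  have hDint : IntegrableOn D (Ioi 0) := by
    refine integrableOn_Ioi_of_intervalIntegral_norm_bounded (l := atTop) (b := fun t : ℝ => t)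
      M 0 (fun t => (hDc.integrableOn_Icc).mono_set Ioc_subset_Icc_self) tendsto_id ?_
    filter_upwards [eventually_ge_atTop τ] with t ht
    simp only [Real.norm_of_nonneg (hD0 _)]
    exact (hM t ht).1
  have hDint2 : IntegrableOn (fun t => D (t + τ)) (Ioi 0) := by
    have h1 : IntegrableOn D (Ioi (0 + τ)) := hDint.mono_set (Ioi_subset_Ioi (by linarith))
    have h2 := ((measurePreserving_add_right volume τ).integrableOn_comp_preimage
      (measurableEmbedding_addRight τ) (f := D) (s := Ioi (0 + τ))).2 h1
    simpa [Function.comp_def] using h2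
  have hlim : ∀ i j, Tendsto (fun t => ‖y i t - y j t‖ ^ 2) atTop (nhds 0) := by
    intro i j
    have hint : IntegrableOn (fun t => ‖y i t - y j t‖ ^ 2) (Ioi 0) := by
      refine Integrable.mono' (hDint2.const_mul q⁻¹)
        (Continuous.aestronglyMeasurable (by fun_prop)) ?_
      refine (ae_restrict_iff' measurableSet_Ioi).2 (Eventually.of_forall fun t ht => ?_)
      rw [Real.norm_of_nonneg (sq_nonneg _)]
      exact hpair i j t ht
    refine tendsto_zero_of_hasDerivAt_of_integrableOn_Ioi (a := 0)
      (f' := fun t => 2 * inner ℝ (y i t - y j t) (u i t - u j t)) ?_ ?_ hint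
    · intro t ht
      exact ((hder i t ht).sub (hder j t ht)).norm_sq
    · refine Integrable.mono' (hint.add (hDint.const_mul 4))
        (Continuous.aestronglyMeasurable (by fun_prop)) ?_
      refine (ae_restrict_iff' measurableSet_Ioi).2 (Eventually.of_forall fun t ht => ?_)
      have h1 := abs_real_inner_le_norm (y i t - y j t) (u i t - u j t)
      have h2 := norm_sub_le (u i t) (u j t)
      have h3 : ∀ k, ‖u k t‖ ^ 2 ≤ D t := fun k =>
        (Finset.single_le_sum (f := fun k => ‖u k t‖ ^ 2) (fun k _ => sq_nonneg _)
          (Finset.mem_univ k)).trans (huD t)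
      have h4 : ‖u i t - u j t‖ ^ 2 ≤ 4 * D t := by
        have := pow_le_pow_left₀ (norm_nonneg _) h2 2
        nlinarith [h3 i, h3 j, sq_nonneg (‖u i t‖ - ‖u j t‖)]
      rw [Real.norm_eq_abs, abs_mul, abs_two]
      simp only [Pi.add_apply]
      nlinarith [sq_nonneg (‖y i t - y j t‖ - ‖u i t - u j t‖)]
  have hlim2 : Tendsto (fun t => ∑ i, ∑ j, ‖y i t - y j t‖) atTop (nhds 0) := by
    have : Tendsto (fun t => ∑ i, ∑ j, ‖y i t - y j t‖) atTop
        (nhds (∑ i : Fin N, ∑ j : Fin N, (0:ℝ))) := by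
      refine tendsto_finsetSum _ fun i _ => tendsto_finsetSum _ fun j _ => ?_
      have := (hlim i j).sqrt
      simpa [Real.sqrt_sq] using this
    simpa using this
  refine squeeze_zero' ?_ ?_ hlim2
  · filter_upwards [eventually_ge_atTop 0] with t ht
    obtain ⟨i, j, h⟩ := (hdx t (by linarith)).1
    rw [h]; exact norm_nonneg _
  · filter_upwards [eventually_ge_atTop 0] with t ht
    obtain ⟨i, j, h⟩ := (hdx t (by linarith)).1
    rw [h, ← hyx i t (by linarith), ← hyx j t (by linarith)]
    have h2 := Finset.single_le_sum (f := fun j => ‖y i t - y j t‖)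
      (fun j _ => norm_nonneg _) (Finset.mem_univ j)
    have h3 := Finset.single_le_sum (f := fun i => ∑ j, ‖y i t - y j t‖)
      (fun i _ => Finset.sum_nonneg fun j _ => norm_nonneg _) (Finset.mem_univ i)
    exact h2.trans h3
end

section
/- For any τ > 0, any probability measure P on [0, τ], and any constants 0 < α < β, the scalar equation β − C = α ∫_0^τ e^{C(s+τ)} dP(s) has exactly one solution C > 0, and this solution satisfies C < β − α. -/
open Filter MeasureTheory Set

/-- For any τ > 0, any probability measure P on [0,τ] and any
0 < α < β, the equation β − C = α ∫₀^τ e^{C(s+τ)} dP(s) has exactly one solution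
C > 0, and this solution satisfies C < β − α. -/
theorem halanay_characteristic_equation_unique_root
    (τ α β : ℝ) (hτ : 0 < τ) (hα : 0 < α) (hαβ : α < β)
    (P : Measure ℝ) [IsProbabilityMeasure P] (hP : P (Icc (0:ℝ) τ)ᶜ = 0) :
    ∃ C : ℝ, 0 < C ∧ C < β - α ∧
      β - C = α * (∫ s in Icc (0:ℝ) τ, Real.exp (C * (s + τ)) ∂P) ∧
      ∀ C' : ℝ, 0 < C' →
        β - C' = α * (∫ s in Icc (0:ℝ) τ, Real.exp (C' * (s + τ)) ∂P) → C' = C := by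
  have hPI : P (Icc (0:ℝ) τ) = 1 := (prob_compl_eq_zero_iff measurableSet_Icc).1 hP
  set G : ℝ → ℝ := fun C => ∫ s in Icc (0:ℝ) τ, Real.exp (C * (s + τ)) ∂P with hG
  have hcont : Continuous G := by
    apply continuous_parametric_integral_of_continuous (μ := P)
      (f := fun C s => Real.exp (C * (s + τ))) _ isCompact_Icc
    unfold Function.uncurry
    fun_prop
  have hint : ∀ C : ℝ, IntegrableOn (fun s => Real.exp (C * (s + τ))) (Icc (0:ℝ) τ) P := by
    intro C
    apply ContinuousOn.integrableOn_compact isCompact_Icc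
    fun_prop
  have hmono : Monotone G := by
    intro a b hab
    apply setIntegral_mono_on (hint a) (hint b) measurableSet_Icc
    intro s hs
    apply Real.exp_le_exp.2
    have := hs.1
    exact mul_le_mul_of_nonneg_right hab (by linarith)
  have hG0 : G 0 = 1 := by simp [hG, Measure.real, hPI]
  have hG1 : ∀ C, 0 < C → 1 < G C := by
    intro C hC
    have h1 : ∫ s in Icc (0:ℝ) τ, Real.exp (C * τ) ∂P ≤ G C := by
      apply setIntegral_mono_on _ (hint C) measurableSet_Icc
      · intro s hs
        apply Real.exp_le_exp.2
        have := hs.1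
        exact mul_le_mul_of_nonneg_left (by linarith) hC.le
      · exact integrable_const _
    have h2 : ∫ s in Icc (0:ℝ) τ, Real.exp (C * τ) ∂P = Real.exp (C * τ) := by
      simp [Measure.real, hPI]
    have h3 : 1 < Real.exp (C * τ) := Real.one_lt_exp_iff.2 (by positivity)
    linarith
  have hbig := hG1 (β - α) (by linarith)
  have hivt := intermediate_value_Ioo (f := fun C => C + α * G C) (a := 0) (b := β - α)
    (by linarith) (by fun_prop)
  obtain ⟨C, hC, hCe⟩ := hivt (show β ∈ Ioo _ _ from
    ⟨by simp only [hG0]; linarith, by show β < β - α + α * G (β - α); nlinarith⟩)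
  have hCe' : C + α * G C = β := hCe
  refine ⟨C, hC.1, hC.2, by show β - C = α * G C; linarith, ?_⟩
  intro C' _ h
  have h' : β - C' = α * G C' := h
  rcases lt_trichotomy C' C with hlt | heq | hgt
  · have := mul_le_mul_of_nonneg_left (hmono hlt.le) hα.le
    linarith
  · exact heq
  · have := mul_le_mul_of_nonneg_left (hmono hgt.le) hα.le
    linarith
end

section
/- Nonexpansivity of the transmission-delay system: assume the communication weights satisfy ∑_{j≠i} ψ_ij(t) ≤ 1 for all t ≥ 0 and all i. Then, along any solution of the transmission-delay Hegselmann–Krause system, the group radius R_x(t) := max_{i} |x_i(t)| satisfies R_x(t) ≤ R_x^0 := max_{s ∈ [−τ, 0]} R_x(s) for all t ≥ 0. -/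
open Filter MeasureTheory Set

lemma le_of_deriv_nonpos_above (f f' : ℝ → ℝ) (a b C : ℝ) (hab : a ≤ b)
    (hf : ContinuousOn f (Icc a b)) (ha : f a ≤ C)
    (hd : ∀ t ∈ Ioo a b, HasDerivAt f (f' t) t)
    (hn : ∀ t ∈ Ioo a b, C < f t → f' t ≤ 0) : f b ≤ C := by
  by_contra! hb
  have hcl : IsClosed (Icc a b ∩ f ⁻¹' Iic C) := hf.preimage_isClosed_of_isClosed isClosed_Icc isClosed_Iic
  have hK : IsCompact (Icc a b ∩ f ⁻¹' Iic C) :=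
    isCompact_Icc.of_isClosed_subset hcl inter_subset_left
  obtain ⟨s, ⟨⟨hsI, hsC⟩, hsm⟩⟩ := hK.exists_isGreatest ⟨a, ⟨le_refl _, hab⟩, ha⟩
  have hsC' : f s ≤ C := hsC
  have hanti : AntitoneOn f (Icc s b) := by
    apply antitoneOn_of_deriv_nonpos (convex_Icc s b)
    · exact hf.mono (Icc_subset_Icc_left hsI.1)
    · intro t ht
      rw [interior_Icc] at ht
      exact (hd t ⟨hsI.1.trans_lt ht.1, ht.2⟩).differentiableAt.differentiableWithinAt
    · intro t ht
      rw [interior_Icc] at ht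
      have ht' : t ∈ Ioo a b := ⟨hsI.1.trans_lt ht.1, ht.2⟩
      rw [(hd t ht').deriv]
      apply hn t ht'
      by_contra! h
      exact absurd (hsm ⟨⟨ht'.1.le, ht'.2.le⟩, h⟩) (not_le.2 ht.1)
  have := hanti ⟨le_refl _, hsI.2⟩ ⟨hsI.2, le_refl _⟩ hsI.2
  linarith

/-- Nonexpansivity of the transmission-delay Hegselmann–Krause system:
under sub-stochasticity of the weights, the group radius R_x(t) = max_i |x_i(t)| stays
below its maximum R_x⁰ over the initial interval [-τ,0], for all t ≥ 0. -/
theorem transmission_delay_nonexpansivity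
    (N d : ℕ) (hN : 2 ≤ N) (hd : 1 ≤ d) (τ : ℝ) (hτ : 0 < τ)
    (x : Fin N → ℝ → EuclideanSpace ℝ (Fin d))
    (ψ : Fin N → Fin N → ℝ → ℝ)
    (hxc : ∀ i, ContinuousOn (x i) (Ici (-τ)))
    (hψc : ∀ i j, i ≠ j → ContinuousOn (ψ i j) (Ici 0))
    (hψnn : ∀ i j, i ≠ j → ∀ t, 0 ≤ t → 0 ≤ ψ i j t)
    -- the transmission-delay Hegselmann–Krause system
    (hode : ∀ i, ∀ t : ℝ, 0 < t → HasDerivAt (x i)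
      (∑ j ∈ Finset.univ.erase i, ψ i j t • (x j (t - τ) - x i t)) t)
    -- sub-stochasticity: ∑_{j≠i} ψ_ij(t) ≤ 1
    (hsub : ∀ t : ℝ, 0 ≤ t → ∀ i, ∑ j ∈ Finset.univ.erase i, ψ i j t ≤ 1)
    -- the group radius R_x(t) := max_i |x_i(t)| and R_x⁰ := max_{[-τ,0]} R_x
    (Rx : ℝ → ℝ)
    (hRx : ∀ t : ℝ, -τ ≤ t → IsGreatest {r | ∃ i, r = ‖x i t‖} (Rx t))
    (Rx0 : ℝ) (hRx0 : IsGreatest {r | ∃ s ∈ Icc (-τ) (0:ℝ), r = Rx s} Rx0) :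
    ∀ t : ℝ, 0 ≤ t → Rx t ≤ Rx0 := by
  have h0 : ∀ t, -τ ≤ t → t ≤ 0 → ∀ i, ‖x i t‖ ≤ Rx0 := fun t h1 h2 i =>
    ((hRx t h1).2 ⟨i, rfl⟩).trans (hRx0.2 ⟨t, ⟨h1, h2⟩, rfl⟩)
  have hR0 : 0 ≤ Rx0 :=
    (norm_nonneg _).trans (h0 0 (by linarith) le_rfl ⟨0, by omega⟩)
  have key : ∀ n : ℕ, ∀ t, -τ ≤ t → t ≤ n * τ → ∀ i, ‖x i t‖ ≤ Rx0 := by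
    intro n
    induction n with
    | zero => intro t h1 h2; exact h0 t h1 (by simpa using h2)
    | succ n ih =>
      intro t h1 h2 i
      rcases le_total t 0 with ht | ht
      · exact h0 t h1 ht i
      push_cast at h2
      have hsq : ‖x i t‖ ^ 2 ≤ Rx0 ^ 2 := by
        refine le_of_deriv_nonpos_above (fun s => ‖x i s‖ ^ 2)
          (fun s => 2 * inner ℝ (x i s)
            (∑ j ∈ Finset.univ.erase i, ψ i j s • (x j (s - τ) - x i s))) 0 t _ ht ?_ ?_ ?_ ?_
        · exact (((hxc i).mono (fun s hs => by
            simp only [mem_Ici]; linarith [hs.1])).norm).pow 2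
        · have := h0 0 (by linarith) le_rfl i
          exact pow_le_pow_left₀ (norm_nonneg _) this 2
        · intro s hs
          exact (hode i s hs.1).norm_sq
        · intro s hs hlt
          have hlt' : Rx0 < ‖x i s‖ := lt_of_pow_lt_pow_left₀ 2 (norm_nonneg _) hlt
          have : inner ℝ (x i s)
            (∑ j ∈ Finset.univ.erase i, ψ i j s • (x j (s - τ) - x i s)) ≤ 0 := by
            rw [inner_sum]
            apply Finset.sum_nonpos
            intro j hj
            rw [inner_smul_right, inner_sub_right, real_inner_self_eq_norm_sq]
            apply mul_nonpos_of_nonneg_of_nonpos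
              (hψnn i j (Finset.ne_of_mem_erase hj).symm s hs.1.le)
            have hj' := ih (s - τ) (by linarith [hs.1]) (by linarith [hs.2]) j
            have hc := real_inner_le_norm (x i s) (x j (s - τ))
            nlinarith [norm_nonneg (x i s)]
          linarith
      exact abs_le_of_sq_le_sq' hsq hR0 |>.2
  intro t ht
  obtain ⟨i, hi⟩ := (hRx t (by linarith)).1
  obtain ⟨n, hn⟩ := exists_nat_ge (t / τ)
  rw [hi]
  exact key n t (by linarith) ((div_le_iff₀ hτ).1 hn) i
end

section
/- One-dimensional invariance of the convex hull: let d = 1 and assume the communication weights satisfy ∑_{j≠i} ψ_ij(t) ≤ 1 for all t ≥ 0 and all i. Set m := min_i min_{t ∈ [−τ,0]} x_i(t) and M := max_i max_{t ∈ [−τ,0]} x_i(t). Then, along any solution of the transmission-delay Hegselmann–Krause system, m ≤ x_i(t) ≤ M for all i and all t ≥ 0. -/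
open Filter MeasureTheory Set

lemma barrier_aux (f f' : ℝ → ℝ) (M t : ℝ) (ht : 0 ≤ t) (hc : ContinuousOn f (Icc 0 t))
    (h0 : f 0 ≤ M) (hd : ∀ s, 0 < s → s ≤ t → HasDerivAt f (f' s) s)
    (hs : ∀ s, 0 < s → s ≤ t → M < f s → f' s ≤ 0) : f t ≤ M := by
  have hcl : IsClosed (Icc 0 t ∩ f ⁻¹' Iic M) := hc.preimage_isClosed_of_isClosed isClosed_Icc isClosed_Iic
  have hcomp : IsCompact (Icc 0 t ∩ f ⁻¹' Iic M) :=
    isCompact_Icc.of_isClosed_subset hcl inter_subset_left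
  obtain ⟨s, ⟨⟨hs0, hst⟩, hsM⟩, hub⟩ := hcomp.exists_isGreatest ⟨0, ⟨le_refl _, ht⟩, h0⟩
  have hsM' : f s ≤ M := hsM
  have key : AntitoneOn f (Icc s t) := by
    apply antitoneOn_of_deriv_nonpos (convex_Icc s t) (hc.mono (Icc_subset_Icc_left hs0))
    · intro u hu
      rw [interior_Icc] at hu
      exact (hd u (hs0.trans_lt hu.1) hu.2.le).differentiableAt.differentiableWithinAt
    · intro u hu
      rw [interior_Icc] at hu
      rw [(hd u (hs0.trans_lt hu.1) hu.2.le).deriv]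
      apply hs u (hs0.trans_lt hu.1) hu.2.le
      by_contra hcon
      have := hub ⟨⟨hs0.trans hu.1.le, hu.2.le⟩, not_lt.mp hcon⟩
      exact absurd hu.1 (not_lt.mpr this)
  exact (key ⟨le_refl _, hst⟩ ⟨hst, le_refl _⟩ hst).trans hsM'

lemma upper_aux (N : ℕ) (τ : ℝ) (hτ : 0 < τ)
    (x : Fin N → ℝ → ℝ) (ψ : Fin N → Fin N → ℝ → ℝ)
    (hxc : ∀ i, ContinuousOn (x i) (Ici (-τ)))
    (hψnn : ∀ i j, i ≠ j → ∀ t, 0 ≤ t → 0 ≤ ψ i j t)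
    (hode : ∀ i, ∀ t : ℝ, 0 < t → HasDerivAt (x i)
      (∑ j ∈ Finset.univ.erase i, ψ i j t * (x j (t - τ) - x i t)) t)
    (M : ℝ) (hM : ∀ i, ∀ s ∈ Icc (-τ) (0:ℝ), x i s ≤ M) :
    ∀ i, ∀ t : ℝ, 0 ≤ t → x i t ≤ M := by
  have step : ∀ n : ℕ, ∀ i, ∀ t, -τ ≤ t → t ≤ n * τ → x i t ≤ M := by
    intro n
    induction n with
    | zero =>
      intro i t h1 h2
      exact hM i t ⟨h1, by simpa using h2⟩
    | succ n ih =>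
      intro i t h1 h2
      push_cast at h2
      rcases le_total t 0 with h | h
      · exact hM i t ⟨h1, h⟩
      · refine barrier_aux (x i) _ M t h ((hxc i).mono ?_) (hM i 0 ⟨by linarith, le_refl _⟩)
          (fun s h3 _ => hode i s h3) ?_
        · intro u hu
          exact (by linarith [hu.1] : -τ ≤ u)
        · intro s h3 h4 h5
          apply Finset.sum_nonpos
          intro j hj
          apply mul_nonpos_of_nonneg_of_nonpos
          · exact hψnn i j (Finset.ne_of_mem_erase hj).symm s h3.le
          · have := ih j (s - τ) (by linarith) (by linarith)
            linarith
  intro i t ht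
  obtain ⟨n, hn⟩ := exists_nat_ge (t / τ)
  exact step n i t (by linarith) ((div_le_iff₀ hτ).mp hn)

/-- One-dimensional invariance of the convex hull for the
transmission-delay Hegselmann–Krause system: with m (resp. M) the minimum (resp.
maximum) of the initial datum over [-τ,0], every trajectory stays in [m, M]
for all t ≥ 0. -/
theorem transmission_delay_hull_invariance_1d
    (N : ℕ) (hN : 2 ≤ N) (τ : ℝ) (hτ : 0 < τ)
    (x : Fin N → ℝ → ℝ)
    (ψ : Fin N → Fin N → ℝ → ℝ)
    (hxc : ∀ i, ContinuousOn (x i) (Ici (-τ)))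
    (hψc : ∀ i j, i ≠ j → ContinuousOn (ψ i j) (Ici 0))
    (hψnn : ∀ i j, i ≠ j → ∀ t, 0 ≤ t → 0 ≤ ψ i j t)
    -- the transmission-delay Hegselmann–Krause system
    (hode : ∀ i, ∀ t : ℝ, 0 < t → HasDerivAt (x i)
      (∑ j ∈ Finset.univ.erase i, ψ i j t * (x j (t - τ) - x i t)) t)
    -- sub-stochasticity: ∑_{j≠i} ψ_ij(t) ≤ 1
    (hsub : ∀ t : ℝ, 0 ≤ t → ∀ i, ∑ j ∈ Finset.univ.erase i, ψ i j t ≤ 1)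
    -- m and M: extrema of the initial datum over [-τ,0]
    (m M : ℝ)
    (hm : IsLeast {r | ∃ i, ∃ s ∈ Icc (-τ) (0:ℝ), r = x i s} m)
    (hM : IsGreatest {r | ∃ i, ∃ s ∈ Icc (-τ) (0:ℝ), r = x i s} M) :
    ∀ i, ∀ t : ℝ, 0 ≤ t → m ≤ x i t ∧ x i t ≤ M := by
  intro i t ht
  constructor
  · have := upper_aux N τ hτ (fun i t => - x i t) ψ (fun i => (hxc i).neg) hψnn
      (fun i t ht => by
        have h := (hode i t ht).neg
        rw [← Finset.sum_neg_distrib] at h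
        refine h.congr_deriv (Finset.sum_congr rfl fun j _ => by ring))
      (-m) (fun i s hs => neg_le_neg (hm.2 ⟨i, s, hs, rfl⟩)) i t ht
    exact neg_le_neg_iff.mp this
  · exact upper_aux N τ hτ x ψ hxc hψnn hode M (fun i s hs => hM.2 ⟨i, s, hs, rfl⟩) i t ht
end

section
/- Convexity (contraction) lemma: let N ≥ 3 and let x_1, …, x_N ∈ ℝ^d with diameter d_x := max_{i,j} |x_i − x_j|. Fix i ≠ k in {1, …, N} and nonnegative coefficients η^i_j (j ≠ i) and η^k_j (j ≠ k) with ∑_{j≠i} η^i_j = 1 and ∑_{j≠k} η^k_j = 1. If μ ≥ 0 satisfies μ ≤ min{ min_{j≠i} η^i_j, min_{j≠k} η^k_j }, then |∑_{j≠i} η^i_j x_j − ∑_{j≠k} η^k_j x_j| ≤ (1 − (N−2)μ) d_x. -/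
open Filter MeasureTheory Set

theorem convex_aux {n : ℕ} {E : Type*} [NormedAddCommGroup E] [NormedSpace ℝ E]
    (x : Fin n → E) (D c : ℝ) (hD : ∀ i j, ‖x i - x j‖ ≤ D) (a b : Fin n → ℝ)
    (ha : ∀ j, 0 ≤ a j) (hb : ∀ j, 0 ≤ b j) (sa : ∑ j, a j = c) (sb : ∑ j, b j = c) :
    ‖∑ j, a j • x j - ∑ j, b j • x j‖ ≤ c * D := by
  have hc : 0 ≤ c := sa ▸ Finset.sum_nonneg (fun j _ => ha j)
  rcases hc.eq_or_lt with h0 | hpos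
  · subst h0
    have ha0 : ∀ j, a j = 0 := fun j =>
      (Finset.sum_eq_zero_iff_of_nonneg (fun j _ => ha j)).1 sa j (Finset.mem_univ j)
    have hb0 : ∀ j, b j = 0 := fun j =>
      (Finset.sum_eq_zero_iff_of_nonneg (fun j _ => hb j)).1 sb j (Finset.mem_univ j)
    simp [ha0, hb0]
  · have key : c • (∑ j, a j • x j - ∑ j, b j • x j)
        = ∑ p, ∑ q, (a p * b q) • (x p - x q) := by
      simp only [smul_sub, Finset.sum_sub_distrib]
      congr 1
      · rw [Finset.smul_sum]
        refine Finset.sum_congr rfl fun p _ => ?_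
        rw [← Finset.sum_smul, ← Finset.mul_sum, sb, smul_smul, mul_comm]
      · rw [Finset.sum_comm, Finset.smul_sum]
        refine Finset.sum_congr rfl fun p _ => ?_
        rw [← Finset.sum_smul, ← Finset.sum_mul, sa, smul_smul]
    have h2 : ‖c • (∑ j, a j • x j - ∑ j, b j • x j)‖ ≤ c * (c * D) := by
      rw [key]
      calc _ ≤ ∑ p, ∑ q, (a p * b q) * D := by
            refine norm_sum_le_of_le _ fun p _ => norm_sum_le_of_le _ fun q _ => ?_
            have := mul_nonneg (ha p) (hb q)
            rw [norm_smul, Real.norm_of_nonneg this]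
            exact mul_le_mul_of_nonneg_left (hD p q) this
        _ = c * (c * D) := by
            simp only [← Finset.sum_mul, ← Finset.mul_sum, sa, sb, mul_assoc]
    rw [norm_smul, Real.norm_of_nonneg hc] at h2
    exact le_of_mul_le_mul_left h2 hpos

/-- Convexity (contraction) lemma: for N ≥ 3 vectors in ℝ^d with
diameter d_x, two convex combinations avoiding indices i and k respectively, whose
coefficients are all ≥ μ ≥ 0, differ by at most (1 − (N−2)μ) d_x. -/
theorem convex_combinations_contraction
    (N d : ℕ) (hN : 3 ≤ N) (hd : 1 ≤ d)
    (x : Fin N → EuclideanSpace ℝ (Fin d))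
    (dx : ℝ) (hdx : IsGreatest {r | ∃ i j, r = ‖x i - x j‖} dx)
    (i k : Fin N) (hik : i ≠ k)
    (ηi ηk : Fin N → ℝ)
    (hηi : ∀ j, j ≠ i → 0 ≤ ηi j) (hηk : ∀ j, j ≠ k → 0 ≤ ηk j)
    (hηi1 : ∑ j ∈ Finset.univ.erase i, ηi j = 1)
    (hηk1 : ∑ j ∈ Finset.univ.erase k, ηk j = 1)
    (μ : ℝ) (hμ : 0 ≤ μ)
    (hμi : ∀ j, j ≠ i → μ ≤ ηi j) (hμk : ∀ j, j ≠ k → μ ≤ ηk j) :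
    ‖(∑ j ∈ Finset.univ.erase i, ηi j • x j) -
        (∑ j ∈ Finset.univ.erase k, ηk j • x j)‖ ≤ (1 - ((N:ℝ) - 2) * μ) * dx := by
  have hD : ∀ p q, ‖x p - x q‖ ≤ dx := fun p q => hdx.2 ⟨p, q, rfl⟩
  let m : Fin N → ℝ := fun j => μ - (if j = i then μ else 0) - (if j = k then μ else 0)
  have sm : ∑ j, m j = ((N:ℝ) - 2) * μ := by
    simp [m, Finset.sum_sub_distrib]
    ring
  have e1 : ∀ (l : Fin N) (η : Fin N → ℝ), ∑ j ∈ Finset.univ.erase l, η j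
      = ∑ j, if j = l then 0 else η j := by
    intro l η
    rw [← Finset.add_sum_erase _ _ (Finset.mem_univ l)]
    simp only [if_true, zero_add]
    exact Finset.sum_congr rfl fun j hj => by rw [if_neg (Finset.ne_of_mem_erase hj)]
  have e2 : ∀ (l : Fin N) (η : Fin N → ℝ), ∑ j ∈ Finset.univ.erase l, η j • x j
      = ∑ j, (if j = l then 0 else η j) • x j := by
    intro l η
    rw [← Finset.add_sum_erase (Finset.univ) _ (Finset.mem_univ l)]
    simp only [if_true, zero_add, zero_smul]
    exact Finset.sum_congr rfl fun j hj => by rw [if_neg (Finset.ne_of_mem_erase hj)]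
  have := convex_aux x dx (1 - ((N:ℝ) - 2) * μ) hD
    (fun j => (if j = i then 0 else ηi j) - m j) (fun j => (if j = k then 0 else ηk j) - m j)
    (by
      intro j
      have h1 := hμi j
      have h2 := hηi j
      by_cases hi : j = i <;> by_cases hk : j = k <;> simp_all [m])
    (by
      intro j
      have h1 := hμk j
      have h2 := hηk j
      by_cases hi : j = i <;> by_cases hk : j = k <;> simp_all [m])
    (by rw [Finset.sum_sub_distrib, ← e1, hηi1, sm])
    (by rw [Finset.sum_sub_distrib, ← e1, hηk1, sm])
  rw [e2, e2]
  simpa only [sub_smul, Finset.sum_sub_distrib, sub_sub_sub_cancel_right] using this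
end

section
/- Delay differential inequality for the diameter under normalized weights: let N ≥ 3 and consider the transmission-delay Hegselmann–Krause system with weights satisfying ∑_{j≠i} ψ_ij(t) = 1 for all t ≥ 0 and all i, and ψ_ij(t) ≥ ψ̲/(N−1) for all t ≥ 0 and all i ≠ j, with some ψ̲ ∈ (0, 1). Then the group diameter d_x is locally Lipschitz on (0, ∞) and satisfies, for almost every t > 0, (d/dt) d_x(t) ≤ (1 − ((N−2)/(N−1)) ψ̲) d_x(t − τ) − d_x(t). -/
open Filter MeasureTheory Set

/-- weighted averages with common mass -/
theorem hk_weights {N : ℕ} (hN : 3 ≤ N) (i j : Fin N) (hij : i ≠ j) (y : Fin N → ℝ) (D m : ℝ)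
    (hD : ∀ k l, y k - y l ≤ D) (a b : Fin N → ℝ)
    (ha : ∀ k, k ≠ i → m ≤ a k) (hb : ∀ k, k ≠ j → m ≤ b k) (hm : 0 ≤ m)
    (has : ∑ k ∈ Finset.univ.erase i, a k = 1) (hbs : ∑ k ∈ Finset.univ.erase j, b k = 1)
    (hc : 0 ≤ 1 - ((N:ℝ) - 2) * m) :
    ∑ k ∈ Finset.univ.erase i, a k * y k - ∑ k ∈ Finset.univ.erase j, b k * y k
      ≤ (1 - ((N:ℝ) - 2) * m) * D := by
  classical
  have hne : (Finset.univ : Finset (Fin N)).Nonempty := ⟨i, Finset.mem_univ i⟩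
  obtain ⟨p, -, hp⟩ := Finset.exists_max_image Finset.univ y hne
  obtain ⟨q, -, hq⟩ := Finset.exists_min_image Finset.univ y hne
  set S : Finset (Fin N) := (Finset.univ.erase i).erase j with hS
  have hji : j ∈ Finset.univ.erase i := by simp [hij.symm]
  have hijm : i ∈ Finset.univ.erase j := by simp [hij]
  have hS' : (Finset.univ.erase j).erase i = S := by rw [hS, Finset.erase_right_comm]
  have hcard : (S.card : ℝ) = (N:ℝ) - 2 := by
    rw [hS, Finset.card_erase_of_mem hji, Finset.card_erase_of_mem (Finset.mem_univ i)]
    simp only [Finset.card_univ, Fintype.card_fin]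
    rw [Nat.sub_sub, Nat.cast_sub (by omega)]; norm_num
  rw [← Finset.add_sum_erase _ _ hji] at has
  rw [← Finset.add_sum_erase _ _ hijm, hS'] at hbs
  rw [← Finset.add_sum_erase _ _ hji, ← Finset.add_sum_erase _ _ hijm, hS']
  have haj := ha j hij.symm
  have hbi := hb i hij
  have h1 : a j * y j ≤ a j * y p :=
    mul_le_mul_of_nonneg_left (hp j (Finset.mem_univ _)) (hm.trans haj)
  have h2 : b i * y q ≤ b i * y i :=
    mul_le_mul_of_nonneg_left (hq i (Finset.mem_univ _)) (hm.trans hbi)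
  have h3 : ∑ k ∈ S, (a k - m) * y k ≤ ∑ k ∈ S, (a k - m) * y p := by
    refine Finset.sum_le_sum fun k hk => mul_le_mul_of_nonneg_left (hp k (Finset.mem_univ _)) ?_
    have : k ≠ i := by rw [hS] at hk; simp at hk; tauto
    linarith [ha k this]
  have h4 : ∑ k ∈ S, (b k - m) * y q ≤ ∑ k ∈ S, (b k - m) * y k := by
    refine Finset.sum_le_sum fun k hk => mul_le_mul_of_nonneg_left (hq k (Finset.mem_univ _)) ?_
    have : k ≠ j := by rw [hS] at hk; simp at hk; tauto
    linarith [hb k this]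
  rw [← Finset.sum_mul] at h3 h4
  simp only [sub_mul, Finset.sum_sub_distrib, Finset.sum_const, nsmul_eq_mul, hcard] at h3 h4
  have h5 := mul_le_mul_of_nonneg_left (hD p q) hc
  have e1 : ∑ k ∈ S, a k = 1 - a j := by linarith
  have e2 : ∑ k ∈ S, b k = 1 - b i := by linarith
  rw [e1] at h3
  rw [e2] at h4
  nlinarith

/-- Delay differential inequality for the diameter under normalized
weights bounded below: the group diameter d_x is locally Lipschitz on (0,∞) and
satisfies, for a.e. t > 0,
(d/dt) d_x(t) ≤ (1 − ((N−2)/(N−1)) ψ̲) d_x(t−τ) − d_x(t). -/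
theorem transmission_delay_diameter_inequality
    (N d : ℕ) (hN : 3 ≤ N) (hd : 1 ≤ d) (τ : ℝ) (hτ : 0 < τ)
    (x : Fin N → ℝ → EuclideanSpace ℝ (Fin d))
    (ψ : Fin N → Fin N → ℝ → ℝ)
    (hxc : ∀ i, ContinuousOn (x i) (Ici (-τ)))
    (hψc : ∀ i j, i ≠ j → ContinuousOn (ψ i j) (Ici 0))
    (hψnn : ∀ i j, i ≠ j → ∀ t, 0 ≤ t → 0 ≤ ψ i j t)
    -- the transmission-delay Hegselmann–Krause system
    (hode : ∀ i, ∀ t : ℝ, 0 < t → HasDerivAt (x i)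
      (∑ j ∈ Finset.univ.erase i, ψ i j t • (x j (t - τ) - x i t)) t)
    -- normalization (convexity) property: ∑_{j≠i} ψ_ij(t) = 1
    (hconv : ∀ t : ℝ, 0 ≤ t → ∀ i, ∑ j ∈ Finset.univ.erase i, ψ i j t = 1)
    -- uniform lower bound ψ_ij(t) ≥ ψ̲/(N-1) with ψ̲ ∈ (0,1)
    (ψl : ℝ) (hψl : ψl ∈ Ioo (0:ℝ) 1)
    (hlb : ∀ t : ℝ, 0 ≤ t → ∀ i j, i ≠ j → ψl / ((N:ℝ) - 1) ≤ ψ i j t)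
    -- the group diameter
    (dx : ℝ → ℝ)
    (hdx : ∀ t : ℝ, -τ ≤ t → IsGreatest {r | ∃ i j, r = ‖x i t - x j t‖} (dx t)) :
    LocallyLipschitzOn (Ioi (0:ℝ)) dx ∧
    ∀ᵐ t : ℝ, 0 < t → DifferentiableAt ℝ dx t ∧
      deriv dx t ≤ (1 - (((N:ℝ) - 2) / ((N:ℝ) - 1)) * ψl) * dx (t - τ) - dx t := by
  classical
  obtain ⟨hψ0, hψ1⟩ := hψl
  have hN3 : (3:ℝ) ≤ N := by exact_mod_cast hN
  -- local Lipschitz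
  have hloc : ∀ t : ℝ, 0 < t → ∃ K : NNReal, ∃ s ∈ nhds t, LipschitzOnWith K dx s := by
    intro t ht
    have hst : ∀ i, HasStrictDerivAt (x i)
        (∑ j ∈ Finset.univ.erase i, ψ i j t • (x j (t - τ) - x i t)) t := by
      intro i
      refine hasStrictDerivAt_of_hasDerivAt_of_continuousAt (f' := fun t =>
        ∑ j ∈ Finset.univ.erase i, ψ i j t • (x j (t - τ) - x i t)) ?_ ?_
      · filter_upwards [lt_mem_nhds ht] with s hs using hode i s hs
      · refine tendsto_finsetSum _ fun j hj => ?_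
        have hij : i ≠ j := (Finset.ne_of_mem_erase hj).symm
        have c1 : ContinuousAt (ψ i j) t := (hψc i j hij).continuousAt (Ici_mem_nhds ht)
        have c2 : ContinuousAt (x j) (t - τ) :=
          (hxc j).continuousAt (Ici_mem_nhds (by linarith))
        have c3 : ContinuousAt (fun s => x j (s - τ)) t :=
          ContinuousAt.comp (f := fun s : ℝ => s - τ) c2 (by fun_prop)
        exact c1.smul (c3.sub (hode i t ht).continuousAt)
    have hL : ∀ i, ∃ K : NNReal, ∃ s ∈ nhds t, LipschitzOnWith K (x i) s :=
      fun i => (hst i).hasStrictFDerivAt.exists_lipschitzOnWith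
    choose K s hs hK using hL
    refine ⟨2 * ∑ i, K i, (⋂ i, s i) ∩ Ioi 0, Filter.inter_mem
      (Filter.iInter_mem.2 hs) (Ioi_mem_nhds ht), ?_⟩
    have key : ∀ u ∈ (⋂ i, s i) ∩ Ioi (0:ℝ), ∀ v ∈ (⋂ i, s i) ∩ Ioi (0:ℝ),
        dx u ≤ dx v + (2 * ∑ i, K i : NNReal) * dist u v := by
      rintro u ⟨hu, hu0⟩ v ⟨hv, hv0⟩
      rw [mem_iInter] at hu hv
      simp only [mem_Ioi] at hu0 hv0
      obtain ⟨⟨i, j, hij⟩, -⟩ := hdx u (by linarith)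
      have hv2 : ‖x i v - x j v‖ ≤ dx v := (hdx v (by linarith)).2 ⟨i, j, rfl⟩
      have b : ∀ i, ‖x i u - x i v‖ ≤ (∑ i, (K i : ℝ)) * dist u v := by
        intro i
        rw [← dist_eq_norm]
        refine ((hK i).dist_le_mul u (hu i) v (hv i)).trans ?_
        gcongr
        exact Finset.single_le_sum (f := fun i => (K i : ℝ)) (fun i _ => (K i).2)
          (Finset.mem_univ i)
      have e : x i u - x j u = (x i v - x j v) + ((x i u - x i v) - (x j u - x j v)) := by abel
      have n1 := norm_add_le (x i v - x j v) ((x i u - x i v) - (x j u - x j v))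
      have n2 := norm_sub_le (x i u - x i v) (x j u - x j v)
      rw [← e] at n1
      push_cast
      linarith [b i, b j]
    exact LipschitzOnWith.of_le_add_mul _ key
  refine ⟨fun t ht => ?_, ?_⟩
  · obtain ⟨K, s, hs, h⟩ := hloc t ht
    exact ⟨K, s, mem_nhdsWithin_of_mem_nhds hs, h⟩
  have hae : ∀ᵐ t : ℝ, 0 < t → DifferentiableAt ℝ dx t := by
    rw [ae_iff]
    refine measure_null_of_locally_null _ fun t ht => ?_
    simp only [mem_ofPred_eq, Classical.not_imp] at ht
    obtain ⟨K, s, hs, h⟩ := hloc t ht.1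
    obtain ⟨w, hws, hwo, htw⟩ := mem_nhds_iff.1 hs
    have := (h.mono hws).ae_differentiableWithinAt_of_mem_real
    rw [ae_iff] at this
    refine ⟨_, inter_mem_nhdsWithin _ (hwo.mem_nhds htw), measure_mono_null ?_ this⟩
    rintro r ⟨hr, hrw⟩ hc
    simp only [mem_ofPred_eq, Classical.not_imp] at hr
    exact hr.2 ((hc hrw).differentiableAt (hwo.mem_nhds hrw))
  filter_upwards [hae] with t hdiff ht
  refine ⟨hdiff ht, ?_⟩
  have hd' := (hdiff ht).hasDerivAt
  set m := ψl / ((N:ℝ) - 1) with hm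
  have hm0 : 0 ≤ m := div_nonneg hψ0.le (by linarith)
  have hcm : ((N:ℝ) - 2) / ((N:ℝ) - 1) * ψl = ((N:ℝ) - 2) * m := by rw [hm]; ring
  have hc : 0 ≤ 1 - ((N:ℝ) - 2) * m := by
    have : m * ((N:ℝ) - 1) = ψl := by rw [hm]; field_simp [show (N:ℝ) - 1 ≠ 0 by linarith]
    nlinarith
  rw [hcm]
  have hnn : ∀ s, -τ ≤ s → 0 ≤ dx s := by
    intro s hs
    obtain ⟨⟨i, j, hij⟩, -⟩ := hdx s hs
    rw [hij]; exact norm_nonneg _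
  obtain ⟨⟨i, j, hij⟩, -⟩ := hdx t (by linarith)
  have hDτ := hnn (t - τ) (by linarith)
  rcases (hnn t (by linarith)).eq_or_lt with h0 | hpos
  · have hmin : IsLocalMin dx t := by
      filter_upwards [lt_mem_nhds ht] with s hs
      rw [← h0]; exact hnn s (by linarith)
    rw [hmin.deriv_eq_zero, ← h0, sub_zero]
    exact mul_nonneg hc hDτ
  have hne : i ≠ j := by
    rintro rfl
    simp at hij; linarith
  set u := x i t - x j t with hu
  -- compare with the linear functional along u
  have hA : ∀ i, HasDerivAt (fun s => inner ℝ u (x i s))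
      (∑ k ∈ Finset.univ.erase i, ψ i k t * inner ℝ u (x k (t - τ)) - inner ℝ u (x i t)) t := by
    intro i
    have h := (innerSL ℝ u).hasFDerivAt.comp_hasDerivAt t (hode i t ht)
    refine h.congr_deriv ?_
    simp only [map_sum, map_smul, map_sub, innerSL_apply_apply, smul_eq_mul, mul_sub,
      Finset.sum_sub_distrib]
    rw [← Finset.sum_mul, hconv t ht.le i, one_mul]
  have hB := ((hd'.const_mul (dx t)).sub ((hA i).sub (hA j)))
  have hmin : IsLocalMin ((fun s => dx t * dx s) -
      ((fun s => inner ℝ u (x i s)) - (fun s => inner ℝ u (x j s)))) t := by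
    filter_upwards [lt_mem_nhds ht] with s hs
    simp only [Pi.sub_apply]
    rw [← inner_sub_right, ← inner_sub_right, ← hu, real_inner_self_eq_norm_sq, ← hij]
    have h1 := real_inner_le_norm u (x i s - x j s)
    have h2 : ‖x i s - x j s‖ ≤ dx s := (hdx s (by linarith)).2 ⟨i, j, rfl⟩
    rw [← hij] at h1
    nlinarith
  have hz := hmin.hasDerivAt_eq_zero hB
  have hW := hk_weights hN i j hne (fun k => inner ℝ u (x k (t - τ))) (dx t * dx (t - τ)) m
    (fun k l => by
      rw [← inner_sub_right]
      refine (real_inner_le_norm _ _).trans ?_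
      rw [← hij]
      exact mul_le_mul_of_nonneg_left ((hdx (t - τ) (by linarith)).2 ⟨k, l, rfl⟩) hpos.le)
    (fun k => ψ i k t) (fun k => ψ j k t) (fun k hk => hlb t ht.le i k hk.symm)
    (fun k hk => hlb t ht.le j k hk.symm) hm0 (hconv t ht.le i) (hconv t ht.le j) hc
  have hs : (inner ℝ u (x i t) : ℝ) - inner ℝ u (x j t) = dx t * dx t := by
    rw [← inner_sub_right, ← hu, real_inner_self_eq_norm_sq, ← hij, sq]
  refine le_of_mul_le_mul_left ?_ hpos
  linarith
end

section
/- Fluctuation dissipation estimate: consider the reaction-delay Hegselmann–Krause system with symmetric communication weights ψ_ij(t) = ψ_ji(t) satisfying 0 ≤ ψ_ij(t) ≤ 1/(N−1) for all i ≠ j and t ≥ 0. Define X(t) := (1/(2(N−1))) ∑_{i=1}^N |x_i(t)|² and D(t) := (1/(2(N−1))) ∑_{i=1}^N ∑_{j≠i} ψ_ij(t) |x_j(t−τ) − x_i(t−τ)|². Then for every δ > 0 and every t > τ: (d/dt) X(t) ≤ (δ − 1) D(t) + (τ/δ) ∫_{t−τ}^{t} D(s) ds. -/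
open Filter MeasureTheory Set

/-- Jensen type bound for the velocity. -/
lemma hk_vel_bound {N d : ℕ} (hN : 2 ≤ N) (i : Fin N) (p : Fin N → ℝ)
    (u : Fin N → EuclideanSpace ℝ (Fin d))
    (hp : ∀ j, i ≠ j → 0 ≤ p j) (hp1 : ∀ j, i ≠ j → p j ≤ 1 / ((N:ℝ) - 1)) :
    ‖∑ j ∈ Finset.univ.erase i, p j • u j‖^2 ≤ ∑ j ∈ Finset.univ.erase i, p j * ‖u j‖^2 := by
  have hN' : (2:ℝ) ≤ N := by exact_mod_cast hN
  have hne : ∀ j ∈ Finset.univ.erase i, i ≠ j := fun j hj => (Finset.ne_of_mem_erase hj).symm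
  have h1 : ‖∑ j ∈ Finset.univ.erase i, p j • u j‖ ≤ ∑ j ∈ Finset.univ.erase i, p j * ‖u j‖ := by
    refine (norm_sum_le _ _).trans (Finset.sum_le_sum fun j hj => ?_)
    rw [norm_smul, Real.norm_of_nonneg (hp j (hne j hj))]
  have h2 : (∑ j ∈ Finset.univ.erase i, p j * ‖u j‖)^2 ≤
      (∑ j ∈ Finset.univ.erase i, p j) * ∑ j ∈ Finset.univ.erase i, p j * ‖u j‖^2 := by
    apply Finset.sum_sq_le_sum_mul_sum_of_sq_le_mul
    · intro j hj; exact hp j (hne j hj)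
    · intro j hj; have := hp j (hne j hj); positivity
    · intro j hj; exact le_of_eq (by ring)
  have h3 : ∑ j ∈ Finset.univ.erase i, p j ≤ 1 := by
    calc _ ≤ ∑ j ∈ Finset.univ.erase i, 1 / ((N:ℝ) - 1) :=
          Finset.sum_le_sum fun j hj => hp1 j (hne j hj)
      _ = 1 := by
          rw [Finset.sum_const, Finset.card_erase_of_mem (Finset.mem_univ _), Finset.card_univ,
            Fintype.card_fin, nsmul_eq_mul, Nat.cast_sub (by omega), Nat.cast_one]
          field_simp
          rw [div_self (by linarith)]
  have h4 : 0 ≤ ∑ j ∈ Finset.univ.erase i, p j * ‖u j‖^2 :=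
    Finset.sum_nonneg fun j hj => by have := hp j (hne j hj); positivity
  have h5 := pow_le_pow_left₀ (norm_nonneg _) h1 2
  nlinarith

/-- Symmetrization. -/
lemma hk_symm {N d : ℕ} (p : Fin N → Fin N → ℝ) (y : Fin N → EuclideanSpace ℝ (Fin d))
    (hs : ∀ i j, i ≠ j → p i j = p j i) :
    2 * ∑ i, inner ℝ (y i) (∑ j ∈ Finset.univ.erase i, p i j • (y j - y i)) =
      - ∑ i, ∑ j ∈ Finset.univ.erase i, p i j * ‖y j - y i‖^2 := by
  have e1 : ∀ i, inner ℝ (y i) (∑ j ∈ Finset.univ.erase i, p i j • (y j - y i)) =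
      ∑ j, p i j * inner ℝ (y i) (y j - y i) := by
    intro i
    rw [inner_sum]
    simp_rw [inner_smul_right]
    apply Finset.sum_erase
    simp
  have e2 : ∀ i, ∑ j ∈ Finset.univ.erase i, p i j * ‖y j - y i‖^2 =
      ∑ j, p i j * ‖y j - y i‖^2 := by
    intro i
    apply Finset.sum_erase
    simp
  simp_rw [e1, e2]
  have e3 : ∑ i, ∑ j, p i j * inner ℝ (y i) (y j - y i) =
      ∑ i, ∑ j, - (p i j * inner ℝ (y j) (y j - y i)) := by
    rw [Finset.sum_comm]
    refine Finset.sum_congr rfl fun i _ => Finset.sum_congr rfl fun j _ => ?_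
    by_cases h : i = j
    · subst h; simp
    · rw [hs i j h, ← neg_sub (y j) (y i), inner_neg_right]; ring
  rw [two_mul]
  nth_rewrite 2 [e3]
  rw [← Finset.sum_add_distrib, ← Finset.sum_neg_distrib]
  refine Finset.sum_congr rfl fun i _ => ?_
  rw [← Finset.sum_add_distrib, ← Finset.sum_neg_distrib]
  refine Finset.sum_congr rfl fun j _ => ?_
  rw [← real_inner_self_eq_norm_sq, inner_sub_left]
  ring

/-- Fluctuation dissipation estimate for the reaction-delay
Hegselmann–Krause system with symmetric weights bounded by 1/(N−1): with
X(t) = (1/(2(N−1))) ∑ᵢ |xᵢ(t)|² and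
D(t) = (1/(2(N−1))) ∑ᵢ ∑_{j≠i} ψ_ij(t) |x_j(t−τ) − x_i(t−τ)|²,
for every δ > 0 and t > τ one has
(d/dt) X(t) ≤ (δ − 1) D(t) + (τ/δ) ∫_{t−τ}^{t} D(s) ds. -/
theorem reaction_delay_fluctuation_dissipation
    (N d : ℕ) (hN : 2 ≤ N) (hd : 1 ≤ d) (τ : ℝ) (hτ : 0 < τ)
    (x : Fin N → ℝ → EuclideanSpace ℝ (Fin d))
    (ψ : Fin N → Fin N → ℝ → ℝ)
    (hxc : ∀ i, ContinuousOn (x i) (Ici (-τ)))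
    (hψc : ∀ i j, i ≠ j → ContinuousOn (ψ i j) (Ici 0))
    (hψnn : ∀ i j, i ≠ j → ∀ t, 0 ≤ t → 0 ≤ ψ i j t)
    -- the reaction-delay Hegselmann–Krause system
    (hode : ∀ i, ∀ t : ℝ, 0 < t → HasDerivAt (x i)
      (∑ j ∈ Finset.univ.erase i, ψ i j t • (x j (t - τ) - x i (t - τ))) t)
    -- symmetry and upper bound of the communication weights
    (hsym : ∀ i j, i ≠ j → ∀ t : ℝ, 0 ≤ t → ψ i j t = ψ j i t)
    (hub : ∀ i j, i ≠ j → ∀ t : ℝ, 0 ≤ t → ψ i j t ≤ 1 / ((N:ℝ) - 1))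
    -- the quadratic fluctuation X and the dissipation functional D
    (X D : ℝ → ℝ)
    (hX : ∀ t : ℝ, X t = (1 / (2 * ((N:ℝ) - 1))) * ∑ i, ‖x i t‖^2)
    (hD : ∀ t : ℝ, D t = (1 / (2 * ((N:ℝ) - 1))) *
      ∑ i, ∑ j ∈ Finset.univ.erase i, ψ i j t * ‖x j (t - τ) - x i (t - τ)‖^2) :
    ∀ δ > (0:ℝ), ∀ t : ℝ, τ < t →
      deriv X t ≤ (δ - 1) * D t + (τ / δ) * ∫ s in (t - τ)..t, D s := by
  intro δ hδ t ht
  have hN' : (2:ℝ) ≤ N := by exact_mod_cast hN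
  have hn : 0 < (N:ℝ) - 1 := by linarith
  have ht0 : 0 < t := hτ.trans ht
  set v : Fin N → ℝ → EuclideanSpace ℝ (Fin d) := fun i s =>
    ∑ j ∈ Finset.univ.erase i, ψ i j s • (x j (s - τ) - x i (s - τ)) with hv
  have hxd : ∀ i s, 0 < s → HasDerivAt (x i) (v i s) s := hode
  -- velocity bound
  have hvD : ∀ s, 0 ≤ s → ∑ i, ‖v i s‖^2 ≤ 2 * ((N:ℝ) - 1) * D s := by
    intro s hs
    rw [hD, ← mul_assoc, mul_one_div_cancel (by positivity), one_mul]
    exact Finset.sum_le_sum fun i _ => hk_vel_bound hN i _ _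
      (fun j hj => hψnn i j hj s hs) (fun j hj => hub i j hj s hs)
  -- derivative of X
  have hXd : HasDerivAt X ((1 / (2 * ((N:ℝ) - 1))) * ∑ i, 2 * inner ℝ (x i t) (v i t)) t := by
    rw [funext hX]
    exact (HasDerivAt.fun_sum fun i _ => (hxd i t ht0).norm_sq).const_mul _
  rw [hXd.deriv]
  -- continuity
  have hxs : ∀ i, ContinuousOn (fun s => x i (s - τ)) (Ici 0) := fun i =>
    (hxc i).comp (by fun_prop) (fun s hs => by
      simp only [mem_Ici] at hs ⊢; linarith)
  have hsub : uIcc (t - τ) t ⊆ Ici 0 := by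
    rw [uIcc_of_le (by linarith)]
    intro s hs
    simp only [mem_Ici]; linarith [hs.1]
  have hvc : ∀ i, ContinuousOn (v i) (Ici 0) := fun i =>
    continuousOn_finsetSum _ fun j hj =>
      (hψc i j (Finset.ne_of_mem_erase hj).symm).smul ((hxs j).sub (hxs i))
  have hDc : ContinuousOn D (Ici 0) := by
    rw [funext hD]
    exact continuousOn_const.mul (continuousOn_finsetSum _ fun i _ =>
      continuousOn_finsetSum _ fun j hj =>
        (hψc i j (Finset.ne_of_mem_erase hj).symm).mul (((hxs j).sub (hxs i)).norm.pow 2))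
  have hDi : IntervalIntegrable D volume (t - τ) t := (hDc.mono hsub).intervalIntegrable
  have hgi : IntervalIntegrable (fun s => ∑ i, inner ℝ (v i s) (v i t)) volume (t - τ) t :=
    ((continuousOn_finsetSum _ fun i _ =>
      (hvc i).inner continuousOn_const).mono hsub).intervalIntegrable
  have hftc : ∫ s in (t - τ)..t, ∑ i, inner ℝ (v i s) (v i t) =
      ∑ i, inner ℝ (x i t) (v i t) - ∑ i, inner ℝ (x i (t - τ)) (v i t) := by
    apply intervalIntegral.integral_eq_sub_of_hasDerivAt
      (f := fun s => ∑ i, inner ℝ (x i s) (v i t)) _ hgi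
    intro s hs
    rw [uIcc_of_le (by linarith)] at hs
    have hs0 : 0 < s := by linarith [hs.1]
    refine HasDerivAt.fun_sum fun i _ => ?_
    simpa using (hxd i s hs0).inner ℝ (hasDerivAt_const s (v i t))
  have hmono : ∫ s in (t - τ)..t, ∑ i, inner ℝ (v i s) (v i t) ≤
      ∫ s in (t - τ)..t, (δ / τ * ((N:ℝ) - 1) * D t + τ / δ * ((N:ℝ) - 1) * D s) := by
    apply intervalIntegral.integral_mono_on (by linarith) hgi
      (intervalIntegrable_const.add (hDi.const_mul _))
    intro s hs
    have hs0 : 0 ≤ s := by linarith [hs.1]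
    have h1 : ∑ i, inner ℝ (v i s) (v i t) ≤
        ∑ i, (δ / τ / 2 * ‖v i t‖^2 + τ / δ / 2 * ‖v i s‖^2) := by
      refine Finset.sum_le_sum fun i _ => (real_inner_le_norm _ _).trans ?_
      have h : δ / τ / 2 * ‖v i t‖^2 + τ / δ / 2 * ‖v i s‖^2 - ‖v i s‖ * ‖v i t‖ =
          (δ * ‖v i t‖ - τ * ‖v i s‖)^2 / (2 * δ * τ) := by
        field_simp
        ring
      have : 0 ≤ (δ * ‖v i t‖ - τ * ‖v i s‖)^2 / (2 * δ * τ) := by positivity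
      linarith
    rw [Finset.sum_add_distrib, ← Finset.mul_sum, ← Finset.mul_sum] at h1
    have h2 := mul_le_mul_of_nonneg_left (hvD t ht0.le) (show 0 ≤ δ / τ / 2 by positivity)
    have h3 := mul_le_mul_of_nonneg_left (hvD s hs0) (show 0 ≤ τ / δ / 2 by positivity)
    linarith
  rw [intervalIntegral.integral_add intervalIntegrable_const (hDi.const_mul _),
    intervalIntegral.integral_const, intervalIntegral.integral_const_mul, hftc, smul_eq_mul] at hmono
  have hS := hk_symm (fun i j => ψ i j t) (fun i => x i (t - τ))
    (fun i j hij => hsym i j hij t ht0.le)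
  have hDt : ∑ i, ∑ j ∈ Finset.univ.erase i, ψ i j t * ‖x j (t - τ) - x i (t - τ)‖^2 =
      2 * ((N:ℝ) - 1) * D t := by
    rw [hD, ← mul_assoc, mul_one_div_cancel (by positivity), one_mul]
  rw [hDt] at hS
  change 2 * ∑ i, inner ℝ (x i (t - τ)) (v i t) = _ at hS
  rw [← Finset.mul_sum, one_div, inv_mul_le_iff₀ (by positivity)]
  have e : (t - (t - τ)) * (δ / τ * ((N:ℝ) - 1) * D t) = δ * ((N:ℝ) - 1) * D t := by
    field_simp
    ring
  rw [e] at hmono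
  linarith
end

section
/- Stability of the characteristic equation for the two-agent transmission-delay model: for every τ > 0, every complex root ξ ∈ ℂ of the characteristic equation ξ + e^{−ξτ} + 1 = 0 has strictly negative real part. -/
/-- Stability of the characteristic equation for the two-agent
transmission-delay model: for every τ > 0, every complex root ξ of
ξ + e^{−ξτ} + 1 = 0 has strictly negative real part. -/
theorem characteristic_equation_stable
    (τ : ℝ) (hτ : 0 < τ) (ξ : ℂ)
    (hroot : ξ + Complex.exp (-(ξ * (τ : ℂ))) + 1 = 0) :
    ξ.re < 0 := by
  by_contra hneg
  have ha : 0 ≤ ξ.re := not_lt.mp hneg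
  have h1 : ‖Complex.exp (-(ξ * (τ : ℂ)))‖ ≤ 1 := by
    rw [Complex.norm_exp, Real.exp_le_one_iff]
    have : (-(ξ * (τ : ℂ))).re = -(ξ.re * τ) := by simp
    rw [this]
    have := mul_nonneg ha hτ.le
    linarith
  have h2 : Complex.exp (-(ξ * (τ : ℂ))) = -(ξ + 1) := by linear_combination hroot
  have h3 : Complex.normSq (ξ + 1) ≤ 1 := by
    rw [h2, norm_neg] at h1
    rw [Complex.normSq_eq_norm_sq]
    nlinarith [norm_nonneg (ξ + 1)]
  rw [Complex.normSq_apply] at h3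
  simp only [Complex.add_re, Complex.add_im, Complex.one_re, Complex.one_im, add_zero] at h3
  have hre : ξ.re = 0 := by nlinarith [mul_self_nonneg ξ.re, mul_self_nonneg ξ.im]
  have him : ξ.im = 0 := by
    rw [hre] at h3
    have : ξ.im * ξ.im = 0 := by nlinarith [mul_self_nonneg ξ.im]
    exact mul_self_eq_zero.mp this
  have h0 : ξ = 0 := Complex.ext hre him
  rw [h0] at hroot
  norm_num at hroot
end

section
/- Iterated contraction lemma: let Γ̄ : [0, ∞) → ℝ be a continuous function with 0 ≤ Γ̄(D) ≤ 1 for all D ≥ 0 and Γ̄(D) > 0 for all D > 0. If (D_k)_{k∈ℕ} is a sequence of nonnegative real numbers satisfying D_{k+1} ≤ (1 − Γ̄(D_k)) D_k for all k, then (D_k) is nonincreasing and lim_{k→∞} D_k = 0. -/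
open Filter Set

/-- Iterated contraction lemma: if Γ̄ : [0,∞) → ℝ is continuous with
0 ≤ Γ̄(D) ≤ 1 for all D ≥ 0 and Γ̄(D) > 0 for D > 0, and (D_k) is a nonnegative
sequence with D_{k+1} ≤ (1 − Γ̄(D_k)) D_k, then (D_k) is nonincreasing and tends
to 0. -/
theorem iterated_contraction
    (Γ : ℝ → ℝ)
    (hΓc : ContinuousOn Γ (Ici 0))
    (hΓ01 : ∀ D : ℝ, 0 ≤ D → 0 ≤ Γ D ∧ Γ D ≤ 1)
    (hΓpos : ∀ D : ℝ, 0 < D → 0 < Γ D)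
    (D : ℕ → ℝ)
    (hDnn : ∀ k, 0 ≤ D k)
    (hrec : ∀ k, D (k + 1) ≤ (1 - Γ (D k)) * D k) :
    Antitone D ∧ Tendsto D atTop (nhds 0) := by
  have hanti : Antitone D := by
    refine antitone_nat_of_succ_le fun k => ?_
    nlinarith [hrec k, mul_nonneg (hΓ01 (D k) (hDnn k)).1 (hDnn k)]
  refine ⟨hanti, ?_⟩
  have hbdd : BddBelow (range D) := ⟨0, by rintro _ ⟨k, rfl⟩; exact hDnn k⟩
  obtain ⟨L, hL⟩ : ∃ L, Tendsto D atTop (nhds L) := ⟨_, tendsto_atTop_ciInf hanti hbdd⟩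
  have hL0 : 0 ≤ L := ge_of_tendsto' hL hDnn
  have hΓL : Tendsto (fun k => Γ (D k)) atTop (nhds (Γ L)) :=
    (hΓc L hL0).tendsto.comp
      (tendsto_nhdsWithin_iff.2 ⟨hL, Eventually.of_forall hDnn⟩)
  have hle : L ≤ (1 - Γ L) * L :=
    le_of_tendsto_of_tendsto' ((tendsto_add_atTop_iff_nat 1).2 hL)
      ((tendsto_const_nhds.sub hΓL).mul hL) hrec
  rcases hL0.eq_or_lt with h | h
  · rw [h]
    exact hL
  · nlinarith [mul_pos (hΓpos L h) h]
end
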